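/- arXiv:1012.5087 — 3 statements merged into one kernel-verified Lean document; each statement's English description precedes it below -/
import Mathlib

section
/- Let p be a prime, n ≥ 1, and let I be a nonzero proper monomial ideal of ℤ_p[x_1,…,x_n]. Let g ∈ ℤ_p[x_1,…,x_n] be a nonzero polynomial with g(0)=0 that is non-degenerated over F_p with respect to all the faces of its Newton polyhedron Γ(g). Then for every complex s with Re(s) > 0, the zeta function Z_{I,g}(s) = ∫_{ℤ_p^n} |I(x)|^s |g(x)| dμ satisfies Z_{I,g}(s) = Σ_{δ ∈ D_{I,g}} L_δ(s) S_δ(s), where for each cone δ ∈ D_{I,g} (with associated face τ' of Γ(g) and g_δ = g_{τ'}): L_δ = p^{-n}((p−1)^n − N_δ·p/(p+1)) with N_δ = #{a ∈ (F_p^×)^n : ḡ_δ(a) = 0}, and S_δ(s) = Σ_{k ∈ ℕ^n ∩ δ} p^{−m_I(k)s − m_g(k) − σ(k)}, this series converging absolutely. -/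
open MeasureTheory MvPolynomial

/-! Igusa's local zeta function of a monomial ideal `I` and a polynomial
measure `|g(x)||dx|` (Theorem `theformule1`). -/

noncomputable instance (p : ℕ) [Fact p.Prime] : MeasurableSpace ℤ_[p] := borel _
instance (p : ℕ) [Fact p.Prime] : BorelSpace ℤ_[p] := ⟨rfl⟩

/-- The Haar measure on `ℤ_p^n`, normalized so that `μ(ℤ_p^n) = 1`. -/
noncomputable def padicHaar (p : ℕ) [Fact p.Prime] (n : ℕ) : Measure (Fin n → ℤ_[p]) :=
  Measure.addHaarMeasure ⟨⟨Set.univ, isCompact_univ⟩, by simp⟩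

/-- The nonnegative orthant `ℝ_{≥0}^n`. -/
def orthant (n : ℕ) : Set (Fin n → ℝ) := {x | ∀ i, 0 ≤ x i}

/-- Embedding of exponent vectors into `ℝ^n`. -/
def toR {n : ℕ} (ω : Fin n →₀ ℕ) : Fin n → ℝ := fun i => (ω i : ℝ)

/-- Embedding of `ℕ^n` into `ℝ^n`. -/
def toRn {n : ℕ} (k : Fin n → ℕ) : Fin n → ℝ := fun i => (k i : ℝ)

/-- `σ(k) = k_1 + ⋯ + k_n`. -/
def sigmaFn {n : ℕ} (k : Fin n → ℕ) : ℝ := ∑ i, (k i : ℝ)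

/-- The Newton polyhedron `Γ(f)`: the convex hull of `⋃_{ω ∈ supp f} (ω + ℝ_{≥0}^n)`. -/
noncomputable def newtonPoly {p n : ℕ} [Fact p.Prime] (f : MvPolynomial (Fin n) ℤ_[p]) :
    Set (Fin n → ℝ) :=
  convexHull ℝ (⋃ ω ∈ f.support, (fun c => toR ω + c) '' orthant n)

/-- The Newton polyhedron `Γ(I)` of a monomial ideal: the convex hull of
`{ω ∈ ℕ^n : x^ω ∈ I}`. -/
noncomputable def newtonPolyIdeal {p n : ℕ} [Fact p.Prime]
    (I : Ideal (MvPolynomial (Fin n) ℤ_[p])) : Set (Fin n → ℝ) :=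
  convexHull ℝ (toR '' {ω : Fin n →₀ ℕ | monomial ω (1 : ℤ_[p]) ∈ I})

/-- `m_Γ(k) = inf_{x ∈ Γ} k·x`. -/
noncomputable def mP {n : ℕ} (Γ : Set (Fin n → ℝ)) (k : Fin n → ℝ) : ℝ :=
  sInf ((fun x => ∑ i, k i * x i) '' Γ)

/-- The first meet locus `F_Γ(k) = {x ∈ Γ | k·x = m_Γ(k)}`. -/
noncomputable def faceOf {n : ℕ} (Γ : Set (Fin n → ℝ)) (k : Fin n → ℝ) : Set (Fin n → ℝ) :=
  {x ∈ Γ | ∑ i, k i * x i = mP Γ k}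

open Classical in
/-- `g_τ` for `τ = F_{Γ(g)}(k)`: the sum of the terms of `g` supported on the
first meet locus of `k`. -/
noncomputable def facePoly {p n : ℕ} [Fact p.Prime] (g : MvPolynomial (Fin n) ℤ_[p])
    (k : Fin n → ℝ) : MvPolynomial (Fin n) ℤ_[p] :=
  (g.support.filter (fun ω => toR ω ∈ faceOf (newtonPoly g) k)).sum
    (fun ω => monomial ω (g.coeff ω))

/-- Reduction of a polynomial over `ℤ_p` modulo `p`. -/
noncomputable def redp {p n : ℕ} [Fact p.Prime] (g : MvPolynomial (Fin n) ℤ_[p]) :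
    MvPolynomial (Fin n) (ZMod p) :=
  g.map (PadicInt.toZMod)

/-- `g` is non-degenerated over `𝔽_p` with respect to all the faces of its Newton
polyhedron. -/
def NonDeg (p : ℕ) [Fact p.Prime] {n : ℕ} (g : MvPolynomial (Fin n) ℤ_[p]) : Prop :=
  ∀ k ∈ orthant n, ¬ ∃ a : Fin n → ℤ_[p], (∀ i, IsUnit (a i)) ∧
    (p : ℤ_[p]) ∣ eval a (facePoly g k) ∧
    ∀ i, (p : ℤ_[p]) ∣ eval a (pderiv i (facePoly g k))

/-- `|I(x)| = sup {|f(x)| : f ∈ I}`. -/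
noncomputable def idealNorm {p n : ℕ} [Fact p.Prime] (I : Ideal (MvPolynomial (Fin n) ℤ_[p]))
    (x : Fin n → ℤ_[p]) : ℝ :=
  sSup ((fun f => ‖eval x f‖) '' (I : Set (MvPolynomial (Fin n) ℤ_[p])))

/-- The partition `D_{I,g}` of `ℝ_{≥0}^n`: the equivalence classes of
`k ∼ k' ↔ F_I(k) = F_I(k') ∧ F_g(k) = F_g(k')`. -/
noncomputable def DIg {p n : ℕ} [Fact p.Prime] (I : Ideal (MvPolynomial (Fin n) ℤ_[p]))
    (g : MvPolynomial (Fin n) ℤ_[p]) : Set (Set (Fin n → ℝ)) :=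
  {δ | ∃ k ∈ orthant n, δ = {k' ∈ orthant n |
    faceOf (newtonPolyIdeal I) k' = faceOf (newtonPolyIdeal I) k ∧
    faceOf (newtonPoly g) k' = faceOf (newtonPoly g) k}}

open Classical in
/-- For a cone `δ ∈ D_{I,g}`, the polynomial `g_δ = g_{τ'}` where `τ'` is the face of
`Γ(g)` associated to `δ` (computed from any point of `δ`). -/
noncomputable def conePoly {p n : ℕ} [Fact p.Prime] (g : MvPolynomial (Fin n) ℤ_[p])
    (δ : Set (Fin n → ℝ)) : MvPolynomial (Fin n) ℤ_[p] :=
  if h : δ.Nonempty then facePoly g h.some else 0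

/-- `N_δ = #{a ∈ (𝔽_p^×)^n : ḡ_δ(a) = 0}`. -/
noncomputable def Ndelta (p : ℕ) [Fact p.Prime] {n : ℕ} (g : MvPolynomial (Fin n) ℤ_[p])
    (δ : Set (Fin n → ℝ)) : ℕ :=
  Set.ncard {a : Fin n → ZMod p | (∀ i, a i ≠ 0) ∧ eval a (redp (conePoly g δ)) = 0}

/-- The factor `L_δ = p^{-n}((p-1)^n - N_δ·p/(p+1))`. -/
noncomputable def Ldelta (p : ℕ) [Fact p.Prime] {n : ℕ} (g : MvPolynomial (Fin n) ℤ_[p])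
    (δ : Set (Fin n → ℝ)) : ℂ :=
  (p : ℂ) ^ (-(n : ℤ)) * (((p : ℂ) - 1) ^ n - (Ndelta p g δ) * (p : ℂ) / ((p : ℂ) + 1))

/-- The summand of the series `S_δ(s)` at a lattice point `k ∈ ℕ^n ∩ δ`. -/
noncomputable def Sterm (p : ℕ) [Fact p.Prime] {n : ℕ}
    (I : Ideal (MvPolynomial (Fin n) ℤ_[p])) (g : MvPolynomial (Fin n) ℤ_[p])
    (s : ℂ) (k : Fin n → ℕ) : ℂ :=
  (p : ℂ) ^ (-(mP (newtonPolyIdeal I) (toRn k) : ℂ) * s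
    - (mP (newtonPoly g) (toRn k) : ℂ) - (sigmaFn k : ℂ))

/-- The series `S_δ(s) = Σ_{k ∈ ℕ^n ∩ δ} p^{-m_I(k)s - m_g(k) - σ(k)}`. -/
noncomputable def Sdelta (p : ℕ) [Fact p.Prime] {n : ℕ}
    (I : Ideal (MvPolynomial (Fin n) ℤ_[p])) (g : MvPolynomial (Fin n) ℤ_[p])
    (δ : Set (Fin n → ℝ)) (s : ℂ) : ℂ :=
  ∑' k : {k : Fin n → ℕ // toRn k ∈ δ}, Sterm p I g s k


/-- `B` is a finite set of generators of `T` (up to adding nonnegative vectors). -/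
structure GenBy {n : ℕ} (T B : Set (Fin n → ℝ)) : Prop where
  fin : B.Finite
  ne : B.Nonempty
  sub : B ⊆ T
  ge : ∀ t ∈ T, ∃ b ∈ B, b ≤ t

def dotR {n : ℕ} (k x : Fin n → ℝ) : ℝ := ∑ i, k i * x i

lemma dotR_mono {n : ℕ} {k x y : Fin n → ℝ} (hk : k ∈ orthant n) (h : x ≤ y) :
    dotR k x ≤ dotR k y :=
  Finset.sum_le_sum fun i _ => mul_le_mul_of_nonneg_left (h i) (hk i)

lemma GenBy.isLeast {n : ℕ} {T B : Set (Fin n → ℝ)} (h : GenBy T B) {k : Fin n → ℝ}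
    (hk : k ∈ orthant n) :
    (∃ b ∈ B, dotR k b = mP (convexHull ℝ T) k) ∧
      ∀ x ∈ convexHull ℝ T, mP (convexHull ℝ T) k ≤ dotR k x := by
  obtain ⟨b, hb, hmin⟩ := Set.exists_min_image B (dotR k) h.fin h.ne
  have hlow : ∀ x ∈ convexHull ℝ T, dotR k b ≤ dotR k x := by
    have hc : Convex ℝ {x : Fin n → ℝ | dotR k b ≤ dotR k x} := by
      apply convex_halfSpace_ge
      constructor
      · intro x y; simp [dotR, mul_add, Finset.sum_add_distrib]
      · intro c x; simp only [dotR, Pi.smul_apply, smul_eq_mul, Finset.mul_sum]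
        exact Finset.sum_congr rfl fun i _ => by ring
    intro x hx
    refine convexHull_min (fun t ht => ?_) hc hx
    obtain ⟨b', hb', hle⟩ := h.ge t ht
    exact (hmin b' hb').trans (dotR_mono hk hle)
  have hle : IsLeast ((fun x => ∑ i, k i * x i) '' convexHull ℝ T) (dotR k b) := by
    refine ⟨⟨b, subset_convexHull ℝ T (h.sub hb), rfl⟩, ?_⟩
    rintro _ ⟨x, hx, rfl⟩
    exact hlow x hx
  have : mP (convexHull ℝ T) k = dotR k b := hle.csInf_eq
  rw [this]
  exact ⟨⟨b, hb, rfl⟩, hlow⟩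

lemma GenBy.face_sub {n : ℕ} {T B : Set (Fin n → ℝ)} (h : GenBy T B) {k k' : Fin n → ℝ}
    (hk : k ∈ orthant n) (hk' : k' ∈ orthant n)
    (h1 : ∀ b ∈ B, dotR k b = mP (convexHull ℝ T) k → dotR k' b = mP (convexHull ℝ T) k')
    (h2 : ∀ i, k i = 0 → k' i = 0) :
    faceOf (convexHull ℝ T) k ⊆ faceOf (convexHull ℝ T) k' := by
  rintro x ⟨hx, hxk⟩
  refine ⟨hx, ?_⟩
  obtain ⟨ι, _, w, z, hw0, hw1, hz, hsum⟩ := mem_convexHull_iff_exists_fintype.1 hx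
  have key : ∀ q : Fin n → ℝ, (∑ i, q i * x i) = ∑ j, w j * dotR q (z j) := by
    intro q
    rw [← hsum]
    simp only [dotR, Finset.sum_apply, Pi.smul_apply, smul_eq_mul, Finset.mul_sum]
    rw [Finset.sum_comm]
    exact Finset.sum_congr rfl fun i _ => Finset.sum_congr rfl fun j _ => by ring
  have hl := (h.isLeast hk).2
  have heq : ∀ j, w j * (dotR k (z j) - mP (convexHull ℝ T) k) = 0 := by
    have hs : ∑ j, w j * (dotR k (z j) - mP (convexHull ℝ T) k) = 0 := by
      simp only [mul_sub, Finset.sum_sub_distrib, ← Finset.sum_mul, hw1, one_mul]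
      rw [← key, hxk, sub_self]
    intro j
    exact (Finset.sum_eq_zero_iff_of_nonneg (fun j _ => mul_nonneg (hw0 j)
      (sub_nonneg.2 (hl _ (subset_convexHull ℝ T (hz j)))))).1 hs j (Finset.mem_univ _)
  have heq' : ∀ j, w j * dotR k' (z j) = w j * mP (convexHull ℝ T) k' := by
    intro j
    rcases mul_eq_zero.1 (heq j) with h0 | h0
    · simp [h0]
    · congr 1
      obtain ⟨b, hb, hbz⟩ := h.ge _ (hz j)
      have hb1 := hl b (subset_convexHull ℝ T (h.sub hb))
      have hb2 := dotR_mono hk hbz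
      have hb3 : dotR k b = mP (convexHull ℝ T) k := by linarith
      have hs : ∑ i, k i * (z j i - b i) = 0 := by
        simp only [mul_sub, Finset.sum_sub_distrib]
        change dotR k (z j) - dotR k b = 0
        linarith
      have hs2 := (Finset.sum_eq_zero_iff_of_nonneg (fun i _ => mul_nonneg (hk i)
        (sub_nonneg.2 (hbz i)))).1 hs
      rw [← h1 b hb hb3]
      refine Finset.sum_congr rfl fun i _ => ?_
      rcases mul_eq_zero.1 (hs2 i (Finset.mem_univ _)) with h3 | h3
      · simp [h2 i h3]
      · rw [sub_eq_zero.1 h3]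
  rw [key k', Finset.sum_congr rfl fun j _ => heq' j, ← Finset.sum_mul, hw1, one_mul]

lemma GenBy.finite_faces {n : ℕ} {T B : Set (Fin n → ℝ)} (h : GenBy T B) :
    (faceOf (convexHull ℝ T) '' orthant n).Finite := by
  classical
  have := h.fin.to_subtype
  let D : (Fin n → ℝ) → Set B × Set (Fin n) := fun k =>
    ({b | dotR k b.1 = mP (convexHull ℝ T) k}, {i | k i = 0})
  have hD : ∀ k ∈ orthant n, ∀ k' ∈ orthant n, D k = D k' →
      faceOf (convexHull ℝ T) k ⊆ faceOf (convexHull ℝ T) k' := by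
    intro k hk k' hk' he
    obtain ⟨e1, e2⟩ := Prod.ext_iff.1 he
    refine h.face_sub hk hk' (fun b hb hbk => ?_) (fun i hi => ?_)
    · have : (⟨b, hb⟩ : B) ∈ (D k).1 := hbk
      rw [e1] at this; exact this
    · have : i ∈ (D k).2 := hi
      rw [e2] at this; exact this
  refine Set.Finite.of_finite_image (s := faceOf (convexHull ℝ T) '' orthant n) (f := fun F =>
    if hF : ∃ k ∈ orthant n, faceOf (convexHull ℝ T) k = F then D hF.choose else (∅, ∅))
    (Set.toFinite _) ?_
  intro F hF F' hF' he
  have hF1 : ∃ k ∈ orthant n, faceOf (convexHull ℝ T) k = F := hF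
  have hF2 : ∃ k ∈ orthant n, faceOf (convexHull ℝ T) k = F' := hF'
  simp only [dif_pos hF1, dif_pos hF2] at he
  have a1 := hF1.choose_spec
  have a2 := hF2.choose_spec
  rw [← a1.2, ← a2.2]
  exact Set.Subset.antisymm (hD _ a1.1 _ a2.1 he) (hD _ a2.1 _ a1.1 he.symm)

section
variable {p n : ℕ} [Fact p.Prime]

lemma toR_nonneg (ω : Fin n →₀ ℕ) : toR ω ∈ orthant n := fun i => Nat.cast_nonneg _

lemma genBy_poly (g : MvPolynomial (Fin n) ℤ_[p]) (hg : g ≠ 0) :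
    GenBy (⋃ ω ∈ g.support, (fun c => toR ω + c) '' orthant n) (toR '' (g.support : Set _)) where
  fin := g.support.finite_toSet.image _
  ne := by
    have := support_nonempty.2 hg
    exact Set.Nonempty.image _ this
  sub := by
    rintro _ ⟨ω, hω, rfl⟩
    simp only [Set.mem_iUnion]
    exact ⟨ω, hω, 0, fun i => le_rfl, by simp⟩
  ge := by
    intro t ht
    simp only [Set.mem_iUnion] at ht
    obtain ⟨ω, hω, c, hc, rfl⟩ := ht
    exact ⟨toR ω, ⟨ω, hω, rfl⟩, fun i => by simpa using hc i⟩

def expSet (I : Ideal (MvPolynomial (Fin n) ℤ_[p])) : Set (Fin n →₀ ℕ) :=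
  {ω : Fin n →₀ ℕ | monomial ω (1 : ℤ_[p]) ∈ I}

lemma expSet_nonempty {I : Ideal (MvPolynomial (Fin n) ℤ_[p])} (hInz : I ≠ ⊥)
    (hImono : ∃ S : Set (Fin n →₀ ℕ), I = Ideal.span ((fun ω => monomial ω (1 : ℤ_[p])) '' S)) :
    (expSet I).Nonempty := by
  obtain ⟨S, rfl⟩ := hImono
  rcases S.eq_empty_or_nonempty with rfl | ⟨ω, hω⟩
  · simp at hInz
  · exact ⟨ω, Ideal.subset_span ⟨ω, hω, rfl⟩⟩

lemma mem_expSet_of_support {I : Ideal (MvPolynomial (Fin n) ℤ_[p])}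
    (hImono : ∃ S : Set (Fin n →₀ ℕ), I = Ideal.span ((fun ω => monomial ω (1 : ℤ_[p])) '' S))
    {f : MvPolynomial (Fin n) ℤ_[p]} (hf : f ∈ I) {ω : Fin n →₀ ℕ} (hω : ω ∈ f.support) :
    ω ∈ expSet I := by
  classical
  obtain ⟨S, rfl⟩ := hImono
  obtain ⟨a, ha, hle⟩ := mem_ideal_span_monomial_image.1 hf ω hω
  refine mem_ideal_span_monomial_image.2 fun x hx => ⟨a, ha, ?_⟩
  rw [support_monomial, if_neg one_ne_zero, Finset.mem_singleton] at hx
  rwa [hx]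

lemma genBy_ideal {I : Ideal (MvPolynomial (Fin n) ℤ_[p])} (hA : (expSet I).Nonempty) :
    GenBy (toR '' expSet I) (toR '' {ω | Minimal (· ∈ expSet I) ω}) where
  fin := by
    apply Set.Finite.image
    exact WellQuasiOrderedLE.finite_of_isAntichain (setOfPred_minimal_antichain _)
  ne := by
    obtain ⟨ω, hω⟩ := hA
    obtain ⟨m, -, hm⟩ := exists_minimal_le_of_wellFoundedLT (· ∈ expSet I) ω hω
    exact ⟨toR m, m, hm, rfl⟩
  sub := by
    rintro _ ⟨m, hm, rfl⟩
    exact ⟨m, hm.prop, rfl⟩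
  ge := by
    rintro _ ⟨ω, hω, rfl⟩
    obtain ⟨m, hle, hm⟩ := exists_minimal_le_of_wellFoundedLT (· ∈ expSet I) ω hω
    exact ⟨toR m, ⟨m, hm, rfl⟩, fun i => Nat.cast_le.2 (hle i)⟩

lemma DIg_finite {I : Ideal (MvPolynomial (Fin n) ℤ_[p])} (hA : (expSet I).Nonempty)
    {g : MvPolynomial (Fin n) ℤ_[p]} (hg : g ≠ 0) : (DIg I g).Finite := by
  have h1 := (genBy_ideal hA).finite_faces
  have h2 := (genBy_poly g hg).finite_faces
  refine ((h1.prod h2).image (fun F => {k' ∈ orthant n |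
    faceOf (newtonPolyIdeal I) k' = F.1 ∧ faceOf (newtonPoly g) k' = F.2})).subset ?_
  rintro δ ⟨k, hk, rfl⟩
  exact ⟨(faceOf (newtonPolyIdeal I) k, faceOf (newtonPoly g) k),
    ⟨⟨k, hk, rfl⟩, ⟨k, hk, rfl⟩⟩, rfl⟩

lemma toRn_nonneg (k : Fin n → ℕ) : toRn k ∈ orthant n := fun i => Nat.cast_nonneg _

lemma dot_nat (k : Fin n → ℕ) (ω : Fin n →₀ ℕ) :
    dotR (toRn k) (toR ω) = ((∑ i, k i * ω i : ℕ) : ℝ) := by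
  simp [dotR, toRn, toR]

/-- `m_g(k)` is a natural number, attained. -/
lemma mP_poly (g : MvPolynomial (Fin n) ℤ_[p]) (hg : g ≠ 0) (k : Fin n → ℕ) :
    ∃ m : ℕ, mP (newtonPoly g) (toRn k) = m ∧ ∀ ω ∈ g.support, m ≤ ∑ i, k i * ω i := by
  have h := (genBy_poly g hg).isLeast (toRn_nonneg k)
  obtain ⟨⟨_, ⟨ω, hω, rfl⟩, e⟩, h2⟩ := h
  refine ⟨∑ i, k i * ω i, ?_, ?_⟩
  · rw [← dot_nat]; exact e.symm
  · intro ω' hω'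
    have := h2 (toR ω') (subset_convexHull ℝ _ ((genBy_poly g hg).sub ⟨ω', hω', rfl⟩))
    rw [← e, dot_nat, dot_nat] at this
    exact_mod_cast this

lemma mP_ideal {I : Ideal (MvPolynomial (Fin n) ℤ_[p])} (hA : (expSet I).Nonempty)
    (k : Fin n → ℕ) :
    ∃ m : ℕ, mP (newtonPolyIdeal I) (toRn k) = m ∧ (∀ ω ∈ expSet I, m ≤ ∑ i, k i * ω i) ∧
      ∃ ω ∈ expSet I, m = ∑ i, k i * ω i := by
  have h := (genBy_ideal hA).isLeast (toRn_nonneg k)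
  obtain ⟨⟨_, ⟨ω, hω, rfl⟩, e⟩, h2⟩ := h
  refine ⟨∑ i, k i * ω i, ?_, ?_, ω, hω.prop, rfl⟩
  · rw [← dot_nat]; exact e.symm
  · intro ω' hω'
    have := h2 (toR ω') (subset_convexHull ℝ _ ⟨ω', hω', rfl⟩)
    rw [← e, dot_nat, dot_nat] at this
    exact_mod_cast this

lemma mem_face_iff (g : MvPolynomial (Fin n) ℤ_[p]) (hg : g ≠ 0) (k : Fin n → ℕ) {m : ℕ}
    (hm : mP (newtonPoly g) (toRn k) = m) {ω : Fin n →₀ ℕ} (hω : ω ∈ g.support) :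
    toR ω ∈ faceOf (newtonPoly g) (toRn k) ↔ ∑ i, k i * ω i = m := by
  have h1 : toR ω ∈ newtonPoly g := subset_convexHull ℝ _ ((genBy_poly g hg).sub ⟨ω, hω, rfl⟩)
  have := dot_nat k ω
  unfold dotR at this
  simp only [faceOf, Set.mem_ofPred_eq, h1, true_and, hm, this]
  exact_mod_cast Iff.rfl
end


section
variable (p : ℕ) [Fact p.Prime]

instance instIGSC : SecondCountableTopology ℤ_[p] := inferInstance

noncomputable def nuP : Measure ℤ_[p] := Measure.addHaarMeasure ⟨⟨Set.univ, isCompact_univ⟩, by simp⟩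

instance instNuHaar : (nuP p).IsAddHaarMeasure := by unfold nuP; infer_instance
instance instNuProb : IsProbabilityMeasure (nuP p) := ⟨Measure.addHaarMeasure_self⟩

variable (n : ℕ)
instance instPHaar : (padicHaar p n).IsAddHaarMeasure := by unfold padicHaar; infer_instance
instance instPProb : IsProbabilityMeasure (padicHaar p n) := ⟨Measure.addHaarMeasure_self⟩

lemma padicHaar_eq_pi : padicHaar p n = Measure.pi (fun _ : Fin n => nuP p) :=
  Measure.isAddHaarMeasure_eq_of_isProbabilityMeasure _ _

lemma ppos : (0 : ℝ) < p := by exact_mod_cast (Fact.out : p.Prime).pos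
lemma pgt1 : (1 : ℝ) < p := by exact_mod_cast (Fact.out : p.Prime).one_lt

variable {p}
lemma norm_le_iff_toZModPow (x : ℤ_[p]) (k : ℕ) :
    ‖x‖ ≤ (p : ℝ) ^ (-(k:ℤ)) ↔ PadicInt.toZModPow k x = 0 := by
  rw [PadicInt.norm_le_pow_iff_mem_span_pow, ← PadicInt.ker_toZModPow, RingHom.mem_ker]

lemma nu_ball (k : ℕ) : (nuP p) {x | ‖x‖ ≤ (p : ℝ) ^ (-(k:ℤ))} = ((p : ENNReal) ^ k)⁻¹ := by
  let H : AddSubgroup ℤ_[p] := (PadicInt.toZModPow k : ℤ_[p] →+* ZMod (p^k)).toAddMonoidHom.ker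
  have hH : (H : Set ℤ_[p]) = {x | ‖x‖ ≤ (p : ℝ) ^ (-(k:ℤ))} := by
    ext x
    rw [Set.mem_ofPred_eq, norm_le_iff_toZModPow]; rfl
  have hi : H.index = p ^ k := by
    have : NeZero (p ^ k) := ⟨pow_ne_zero _ (Fact.out : p.Prime).ne_zero⟩
    have hsurj : Function.Surjective (PadicInt.toZModPow k : ℤ_[p] →+* ZMod (p^k)).toAddMonoidHom :=
      ZMod.ringHom_surjective _
    rw [AddSubgroup.index_ker, AddMonoidHom.range_eq_top.2 hsurj]
    simp [Nat.card_zmod]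
  have : H.FiniteIndex := ⟨by rw [hi]; exact pow_ne_zero _ (Fact.out : p.Prime).ne_zero⟩
  have hm : MeasurableSet (H : Set ℤ_[p]) := by
    rw [hH]; exact (isClosed_le continuous_norm continuous_const).measurableSet
  have := AddSubgroup.index_mul_measure H hm (nuP p)
  rw [hi, measure_univ, hH] at this
  rw [← ENNReal.eq_inv_of_mul_eq_one_left (a := (nuP p) {x | ‖x‖ ≤ (p : ℝ) ^ (-(k:ℤ))}) (b := (p : ENNReal) ^ k)]
  rw [mul_comm]; exact_mod_cast this

lemma nu_ball_real (k : ℕ) : (nuP p).real {x | ‖x‖ ≤ (p : ℝ) ^ (-(k:ℤ))} = (p : ℝ) ^ (-(k:ℤ)) := by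
  rw [Measure.real, nu_ball]; simp

instance instNoAtoms : NullSingletonClass (nuP p) := by
  have h0 : (nuP p).real {0} = 0 := by
    have h1 : ∀ k : ℕ, (nuP p).real {0} ≤ ((p : ℝ)⁻¹) ^ k := by
      intro k
      have := measureReal_mono (μ := nuP p) (s₁ := {0}) (s₂ := {x | ‖x‖ ≤ (p : ℝ) ^ (-(k:ℤ))})
        (by rintro x rfl; simp)
      rw [nu_ball_real] at this
      simpa using this
    have h2 := tendsto_pow_atTop_nhds_zero_of_lt_one (inv_nonneg.2 (ppos p).le)
      (inv_lt_one_of_one_lt₀ (pgt1 p))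
    exact le_antisymm (ge_of_tendsto' h2 h1) measureReal_nonneg
  refine ⟨fun x => ?_⟩
  have h3 := measure_preimage_add (nuP p) (-x) {0}
  have h4 : (fun h => -x + h) ⁻¹' {0} = ({x} : Set ℤ_[p]) := by
    ext y; simp [neg_add_eq_zero, eq_comm]
  rw [h4] at h3
  rw [h3]
  simpa [Measure.real, ENNReal.toReal_eq_zero_iff] using h0

/-- Scaling -/
lemma comap_scale {G : Type*} [AddCommGroup G] [TopologicalSpace G] [IsTopologicalAddGroup G]
    [CompactSpace G] [SecondCountableTopology G] [MeasurableSpace G] [BorelSpace G]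
    (μ : Measure G) [μ.IsAddHaarMeasure] [IsProbabilityMeasure μ] (φ : G →+ G)
    (hφ : Topology.IsOpenEmbedding φ) :
    μ.comap φ = μ (Set.range φ) • μ := by
  have := Measure.IsAddHaarMeasure.comap (G := G) (mH := inferInstance) μ (f := φ) hφ
  have h := Measure.isAddLeftInvariant_eq_smul (μ.comap φ) μ
  have h1 : (μ.comap φ) Set.univ = μ (Set.range φ) := by
    rw [Measure.comap_apply _ hφ.injective (fun s hs => hφ.measurableEmbedding.measurableSet_image.2 hs) _ MeasurableSet.univ, Set.image_univ]
  have h2 := congrArg (fun m : Measure G => m Set.univ) h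
  simp only [h1, Measure.smul_apply, measure_univ] at h2
  rw [h, h2]
  congr 1
  simp [ENNReal.smul_def]

lemma setIntegral_scale {G : Type*} [AddCommGroup G] [TopologicalSpace G] [IsTopologicalAddGroup G]
    [CompactSpace G] [SecondCountableTopology G] [MeasurableSpace G] [BorelSpace G]
    (μ : Measure G) [μ.IsAddHaarMeasure] [IsProbabilityMeasure μ] (φ : G →+ G)
    (hφ : Topology.IsOpenEmbedding φ) (f : G → ℝ) (U : Set G) (hU : MeasurableSet U) :
    ∫ x in φ '' U, f x ∂μ = μ.real (Set.range φ) * ∫ x in U, f (φ x) ∂μ := by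
  have he := hφ.measurableEmbedding
  have h1 : μ.restrict (φ '' U) = ((μ.comap φ).restrict U).map φ := by
    have := he.restrict_map (μ.comap φ) (φ '' U)
    rw [he.map_comap, Set.preimage_image_eq _ hφ.injective,
      Measure.restrict_restrict (he.measurableSet_image.2 hU),
      Set.inter_eq_self_of_subset_left (Set.image_subset_range _ _)] at this
    exact this
  rw [h1, he.integral_map, comap_scale μ φ hφ, Measure.restrict_smul, integral_smul_measure]
  rfl

lemma openEmb_of {G : Type*} [AddCommGroup G] [TopologicalSpace G] 
    [CompactSpace G] [T2Space G] (φ : G →+ G) (hc : Continuous φ) (hi : Function.Injective φ)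
    (ho : IsOpen (Set.range φ)) : Topology.IsOpenEmbedding φ :=
  ⟨(hc.isClosedEmbedding hi).isEmbedding, ho⟩

lemma pz_ne : (p : ℤ_[p]) ≠ 0 := by exact_mod_cast (Fact.out : p.Prime).ne_zero

lemma dvd_iff_norm (k : ℕ) (x : ℤ_[p]) : ‖x‖ ≤ (p : ℝ) ^ (-(k:ℤ)) ↔ ∃ y, (p : ℤ_[p]) ^ k * y = x := by
  rw [PadicInt.norm_le_pow_iff_mem_span_pow, Ideal.mem_span_singleton]
  exact ⟨fun ⟨y, hy⟩ => ⟨y, hy.symm⟩, fun ⟨y, hy⟩ => ⟨y, hy.symm⟩⟩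

lemma isOpen_ball' (k : ℕ) : IsOpen {x : ℤ_[p] | ‖x‖ ≤ (p : ℝ) ^ (-(k:ℤ))} := by
  have := IsUltrametricDist.isOpen_closedBall (0 : ℤ_[p]) (r := (p : ℝ) ^ (-(k:ℤ)))
    (zpow_ne_zero _ (ppos p).ne')
  convert this using 1
  ext x; simp

lemma norm_lt_one_iff' (x : ℤ_[p]) : ‖x‖ < 1 ↔ ‖x‖ ≤ (p : ℝ) ^ (-((1:ℕ):ℤ)) := by
  rw [PadicInt.norm_le_pow_iff_norm_lt_pow_add_one]; simp

lemma integrable_of_cont {X : Type*} [TopologicalSpace X] [CompactSpace X] [MeasurableSpace X]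
    [BorelSpace X] (μ : Measure X) [IsFiniteMeasure μ] (f : X → ℝ) (hf : Continuous f) :
    Integrable f μ := by
  exact hf.integrable_of_hasCompactSupport (HasCompactSupport.of_compactSpace f)

lemma int_small : ∫ t in {t : ℤ_[p] | ‖t‖ < 1}, ‖t‖ ∂(nuP p) = ((p : ℝ)⁻¹)^2 * ∫ t, ‖t‖ ∂(nuP p) := by
  have hr : Set.range (AddMonoidHom.mulLeft (p : ℤ_[p])) = {x | ‖x‖ ≤ (p : ℝ) ^ (-((1:ℕ):ℤ))} := by
    ext x
    simp only [Set.mem_range, AddMonoidHom.coe_mulLeft, Set.mem_ofPred_eq, dvd_iff_norm, pow_one]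
  have hφ : Topology.IsOpenEmbedding (AddMonoidHom.mulLeft (p : ℤ_[p])) := by
    refine openEmb_of _ (continuous_const.mul continuous_id) (mul_right_injective₀ pz_ne) ?_
    rw [hr]; exact isOpen_ball' 1
  have h := setIntegral_scale (nuP p) _ hφ (fun t => ‖t‖) Set.univ MeasurableSet.univ
  rw [Set.image_univ, hr, nu_ball_real] at h
  simp only [norm_lt_one_iff']
  rw [h]
  simp only [AddMonoidHom.coe_mulLeft, norm_mul, PadicInt.norm_p, Measure.restrict_univ]
  rw [integral_const_mul]
  simp
  ring

lemma int_norm : ∫ t, ‖t‖ ∂(nuP p) = p / (p + 1) := by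
  have h1 := int_small (p := p)
  have hm : MeasurableSet {t : ℤ_[p] | ‖t‖ < 1} :=
    (isOpen_lt continuous_norm continuous_const).measurableSet
  have hi : Integrable (fun t : ℤ_[p] => ‖t‖) (nuP p) := integrable_of_cont _ _ continuous_norm
  have h2 := integral_add_compl hm hi
  have h3 : ∫ t in {t : ℤ_[p] | ‖t‖ < 1}ᶜ, ‖t‖ ∂(nuP p) = 1 - (p:ℝ)⁻¹ := by
    rw [setIntegral_congr_fun (g := fun _ => (1:ℝ)) hm.compl]
    · rw [setIntegral_const, probReal_compl_eq_one_sub hm]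
      simp only [norm_lt_one_iff']
      rw [nu_ball_real]; simp
    · intro t ht
      simp only [Set.mem_compl_iff, Set.mem_ofPred_eq, not_lt] at ht
      exact le_antisymm (PadicInt.norm_le_one _) ht
  rw [h1, h3] at h2
  have hp := pgt1 p
  have hp0 : (p:ℝ) ≠ 0 := (ppos p).ne'
  field_simp at h2 ⊢
  have h4 : ((p:ℝ) - 1) * ((∫ t, ‖t‖ ∂(nuP p)) * (p + 1) - p) = 0 := by
    linear_combination -h2
  rcases mul_eq_zero.1 h4 with h | h <;> linarith

lemma int_class (a z : ℤ_[p]) (h : ‖z - a‖ < 1) :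
    ∫ t in {t : ℤ_[p] | ‖t - a‖ < 1}, ‖t - z‖ ∂(nuP p) = 1 / (p * (p + 1)) := by
  have hs : {t : ℤ_[p] | ‖t - a‖ < 1} = (fun t => t - z) ⁻¹' {t : ℤ_[p] | ‖t‖ < 1} := by
    ext t
    simp only [Set.mem_ofPred_eq, Set.mem_preimage]
    constructor
    · intro h'
      have := PadicInt.norm_lt_one_add h' (z2 := a - z) (by rwa [norm_sub_rev])
      simpa using this
    · intro h'
      have := PadicInt.norm_lt_one_add h' h
      simpa using this
  have hmp : MeasurePreserving (fun t : ℤ_[p] => t - z) (nuP p) (nuP p) :=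
    measurePreserving_sub_right _ _
  have he : MeasurableEmbedding (fun t : ℤ_[p] => t - z) :=
    (Homeomorph.subRight z).measurableEmbedding
  rw [hs, hmp.setIntegral_preimage_emb he (fun t => ‖t‖), int_small, int_norm]
  have hp0 : (p:ℝ) ≠ 0 := (ppos p).ne'
  field_simp
end


section
variable {p : ℕ} [Fact p.Prime] {n : ℕ}

lemma norm_lt_one_toZMod (x : ℤ_[p]) : ‖x‖ < 1 ↔ PadicInt.toZMod x = 0 := by
  rw [← RingHom.mem_ker, PadicInt.ker_toZMod, PadicInt.maximalIdeal_eq_span_p,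
    Ideal.mem_span_singleton, PadicInt.norm_lt_one_iff_dvd]

lemma norm_eq_one_toZMod (x : ℤ_[p]) : ‖x‖ = 1 ↔ PadicInt.toZMod x ≠ 0 := by
  rw [Ne, ← norm_lt_one_toZMod, not_lt]
  exact ⟨fun h => h.ge, fun h => le_antisymm (PadicInt.norm_le_one _) h⟩

lemma toZMod_eval (G : MvPolynomial (Fin n) ℤ_[p]) (u : Fin n → ℤ_[p]) :
    PadicInt.toZMod (eval u G) = eval (fun i => PadicInt.toZMod (u i)) (redp G) := by
  rw [redp, eval_map, ← MvPolynomial.eval₂_id (p := G), MvPolynomial.hom_eval₂]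
  rfl

def ucls (a : Fin n → ZMod p) : Set (Fin n → ℤ_[p]) := {u | ∀ i, PadicInt.toZMod (u i) = a i}

lemma ucls_eq (b : Fin n → ℤ_[p]) : ucls (fun i => PadicInt.toZMod (b i)) =
    Set.pi Set.univ (fun i => {t | ‖t - b i‖ < 1}) := by
  ext u
  simp only [ucls, Set.mem_ofPred_eq, Set.mem_pi, Set.mem_univ, true_imp_iff, norm_lt_one_toZMod,
    map_sub, sub_eq_zero]

lemma exists_lift (a : Fin n → ZMod p) : ∃ b : Fin n → ℤ_[p], a = fun i => PadicInt.toZMod (b i) := by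
  choose f hf using (ZMod.ringHom_surjective (PadicInt.toZMod : ℤ_[p] →+* ZMod p))
  exact ⟨fun i => f (a i), by simp [hf]⟩

lemma meas_ball1 (b : ℤ_[p]) : MeasurableSet {t | ‖t - b‖ < 1} :=
  (isOpen_lt (by fun_prop) continuous_const).measurableSet

lemma nu_cls (b : ℤ_[p]) : (nuP p) {t | ‖t - b‖ < 1} = (p : ENNReal)⁻¹ := by
  have h := (measurePreserving_sub_right (nuP p) b).measure_preimage
    (s := {t : ℤ_[p] | ‖t‖ < 1}) (isOpen_lt continuous_norm continuous_const).measurableSet.nullMeasurableSet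
  rw [show {t | ‖t - b‖ < 1} = (fun t => t - b) ⁻¹' {t : ℤ_[p] | ‖t‖ < 1} from rfl, h]
  simp only [norm_lt_one_iff']
  rw [nu_ball]; simp

lemma meas_ucls (a : Fin n → ZMod p) : MeasurableSet (ucls a) := by
  obtain ⟨b, rfl⟩ := exists_lift a
  rw [ucls_eq]
  exact MeasurableSet.univ_pi fun i => meas_ball1 _

lemma measure_ucls (a : Fin n → ZMod p) : (padicHaar p n).real (ucls a) = ((p : ℝ)⁻¹) ^ n := by
  obtain ⟨b, rfl⟩ := exists_lift a
  rw [ucls_eq, padicHaar_eq_pi, Measure.real, Measure.pi_pi]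
  simp [nu_cls]

lemma cont_eval (G : MvPolynomial (Fin n) ℤ_[p]) : Continuous (fun u : Fin n → ℤ_[p] => ‖eval u G‖) :=
  (MvPolynomial.continuous_eval G).norm

lemma int_ucls_unit (G : MvPolynomial (Fin n) ℤ_[p]) (a : Fin n → ZMod p)
    (ha : eval a (redp G) ≠ 0) : ∫ u in ucls a, ‖eval u G‖ ∂(padicHaar p n) = ((p : ℝ)⁻¹) ^ n := by
  rw [setIntegral_congr_fun (g := fun _ => (1:ℝ)) (meas_ucls a)]
  · simp [measure_ucls]
  · intro u hu
    refine (norm_eq_one_toZMod _).2 ?_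
    rw [toZMod_eval]
    have : (fun i => PadicInt.toZMod (u i)) = a := funext hu
    rwa [this]

/-- `G` restricted to the line in direction `i`. -/
noncomputable def lineP (G : MvPolynomial (Fin n) ℤ_[p]) (i : Fin n) (u : Fin n → ℤ_[p]) :
    Polynomial ℤ_[p] :=
  aeval (Function.update (fun j => Polynomial.C (u j)) i Polynomial.X) G

lemma lineP_eval (G : MvPolynomial (Fin n) ℤ_[p]) (i : Fin n) (u : Fin n → ℤ_[p]) (t : ℤ_[p]) :
    (lineP G i u).eval t = eval (Function.update u i t) G := by
  induction G using MvPolynomial.induction_on with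
  | C a => simp [lineP]
  | add f g hf hg => simp only [lineP, map_add, Polynomial.eval_add] at *; rw [hf, hg]
  | mul_X f j hf =>
    simp only [lineP, map_mul, Polynomial.eval_mul, aeval_X, eval_X] at *; rw [hf]
    congr 1
    by_cases h : j = i
    · subst h; simp
    · simp [h]

lemma lineP_deriv (G : MvPolynomial (Fin n) ℤ_[p]) (i : Fin n) (u : Fin n → ℤ_[p]) :
    (lineP G i u).derivative = lineP (pderiv i G) i u := by
  induction G using MvPolynomial.induction_on with
  | C a => simp [lineP]
  | add f g hf hg => simp only [lineP, map_add] at *; rw [hf, hg]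
  | mul_X f j hf =>
    simp only [lineP, map_mul, Polynomial.derivative_mul, aeval_X, Derivation.leibniz, map_add,
      smul_eq_mul, pderiv_X] at *
    rw [hf]
    by_cases h : j = i
    · subst h; simp; ring
    · simp [h, Pi.single_apply]; ring

lemma line_root (G : MvPolynomial (Fin n) ℤ_[p]) (i : Fin n) (u : Fin n → ℤ_[p])
    (h0 : ‖eval u G‖ < 1) (h1 : ‖eval u (pderiv i G)‖ = 1) :
    ∃ z : ℤ_[p], ‖z - u i‖ < 1 ∧ ∀ t, ‖t - u i‖ < 1 →
      ‖eval (Function.update u i t) G‖ = ‖t - z‖ := by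
  set F := lineP G i u with hF
  have e0 : F.eval (u i) = eval u G := by rw [lineP_eval, Function.update_eq_self]
  have e1 : F.derivative.eval (u i) = eval u (pderiv i G) := by
    rw [lineP_deriv, lineP_eval, Function.update_eq_self]
  obtain ⟨z, hz0, hz1, hz2, -⟩ := hensels_lemma (F := F) (a := u i) (by
    simp only [Polynomial.coe_aeval_eq_eval, e0, e1, h1]; simpa using h0)
  simp only [Polynomial.coe_aeval_eq_eval, e0, e1, h1] at hz0 hz1 hz2
  refine ⟨z, hz1, fun t ht => ?_⟩
  rw [← lineP_eval, ← hF]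
  obtain ⟨k, hk⟩ := Polynomial.binomExpansion F z (t - z)
  have hF' : F.eval t = (F.derivative.eval z + k * (t - z)) * (t - z) := by
    rw [add_sub_cancel, hz0] at hk
    rw [hk]; ring
  have htz : PadicInt.toZMod (t - z) = 0 := by
    rw [← norm_lt_one_toZMod]
    have := PadicInt.norm_lt_one_add ht (z2 := u i - z) (by rwa [norm_sub_rev])
    simpa using this
  have hu : ‖F.derivative.eval z + k * (t - z)‖ = 1 := by
    rw [norm_eq_one_toZMod] at hz2 ⊢
    rw [map_add, map_mul, htz, mul_zero, add_zero]
    exact hz2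
  rw [hF', norm_mul, hu, one_mul]

lemma int_ucls_zero (G : MvPolynomial (Fin n) ℤ_[p]) (a : Fin n → ZMod p)
    (ha : eval a (redp G) = 0) (i : Fin n) (hi : eval a (redp (pderiv i G)) ≠ 0) :
    ∫ u in ucls a, ‖eval u G‖ ∂(padicHaar p n) = ((p : ℝ)⁻¹) ^ n / (p + 1) := by
  obtain _ | m := n
  · exact i.elim0
  obtain ⟨b, rfl⟩ := exists_lift a
  have hmp := (measurePreserving_piFinSuccAbove (fun _ : Fin (m+1) => nuP p) i).symm
  set e := MeasurableEquiv.piFinSuccAbove (fun _ : Fin (m+1) => ℤ_[p]) i with he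
  have hes : ∀ z, e.symm z = i.insertNth z.1 z.2 := fun z => rfl
  rw [padicHaar_eq_pi, ← hmp.setIntegral_preimage_emb e.symm.measurableEmbedding]
  have hset : e.symm ⁻¹' (ucls fun i => PadicInt.toZMod (b i)) =
      {t | ‖t - b i‖ < 1} ×ˢ ucls (fun j => PadicInt.toZMod (b (i.succAbove j))) := by
    ext ⟨t, y⟩
    simp only [Set.mem_preimage, hes, ucls, Set.mem_ofPred_eq, Set.mem_prod, norm_lt_one_toZMod,
      map_sub, sub_eq_zero]
    rw [Fin.forall_iff_succAbove i]
    simp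
  rw [hset, ← Measure.prod_restrict, integral_prod_symm]
  swap
  · rw [Measure.prod_restrict]
    apply Integrable.integrableOn
    apply integrable_of_cont
    refine (cont_eval G).comp ?_
    exact (Continuous.finInsertNth (A := fun _ : Fin (m+1) => ℤ_[p]) i continuous_fst continuous_snd)
  have hm := measure_ucls (p := p) (fun j => PadicInt.toZMod (b (i.succAbove j)))
  rw [padicHaar_eq_pi] at hm
  rw [setIntegral_congr_fun (g := fun _ => (1 / (p * (p + 1)) : ℝ)) (meas_ucls _)]
  · rw [setIntegral_const, hm]
    have hp0 : (p:ℝ) ≠ 0 := (ppos p).ne'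
    rw [smul_eq_mul, pow_succ]
    field_simp
  · intro y hy
    have hu : (fun j => PadicInt.toZMod ((i.insertNth (b i) y : Fin (m+1) → ℤ_[p]) j)) =
        fun j => PadicInt.toZMod (b j) := by
      funext j
      refine Fin.succAboveCases i ?_ (fun j => ?_) j
      · simp
      · simpa using hy j
    obtain ⟨z, hz, hz'⟩ := line_root G i (i.insertNth (b i) y : Fin (m+1) → ℤ_[p])
      (by rw [norm_lt_one_toZMod, toZMod_eval, hu, ha])
      (by rw [norm_eq_one_toZMod, toZMod_eval, hu]; exact hi)
    simp only [Fin.insertNth_apply_same, Fin.update_insertNth] at hz hz'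
    dsimp only
    rw [setIntegral_congr_fun (g := fun t => ‖t - z‖) (meas_ball1 _)]
    · exact int_class _ _ hz
    · intro t ht
      exact hz' t ht

def uset (p n : ℕ) [Fact p.Prime] : Set (Fin n → ℤ_[p]) := {u | ∀ i, ‖u i‖ = 1}

open Classical in
lemma int_units (G : MvPolynomial (Fin n) ℤ_[p])
    (hG : ∀ a : Fin n → ZMod p, (∀ i, a i ≠ 0) → eval a (redp G) = 0 →
      ∃ i, eval a (redp (pderiv i G)) ≠ 0) :
    ∫ u in uset p n, ‖eval u G‖ ∂(padicHaar p n) = ((p : ℝ)⁻¹) ^ n * (((p : ℝ) - 1) ^ n -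
      (Set.ncard {a : Fin n → ZMod p | (∀ i, a i ≠ 0) ∧ eval a (redp G) = 0}) * (p : ℝ) / (p + 1)) := by
  let F : Finset (Fin n → ZMod p) := Fintype.piFinset (fun _ => Finset.univ.erase 0)
  have hF : ∀ a, a ∈ F ↔ ∀ i, a i ≠ 0 := by intro a; simp [F]
  have hU : uset p n = ⋃ a ∈ F, ucls a := by
    ext u
    simp only [uset, Set.mem_ofPred_eq, Set.mem_iUnion, norm_eq_one_toZMod, hF]
    constructor
    · intro h; exact ⟨_, h, fun i => rfl⟩
    · rintro ⟨a, ha, hu⟩ i; rw [hu i]; exact ha i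
  rw [hU, integral_biUnion_finset]
  rotate_left
  · intro a _; exact meas_ucls a
  · intro a _ b _ hab
    refine Set.disjoint_left.2 fun u hu hu' => hab ?_
    funext i; rw [← hu i, ← hu' i]
  · intro a _; exact (integrable_of_cont _ _ (cont_eval G)).integrableOn
  have h1 : ∀ a ∈ F, ∫ u in ucls a, ‖eval u G‖ ∂(padicHaar p n) =
      ((p : ℝ)⁻¹) ^ n * (1 - (if eval a (redp G) = 0 then (p : ℝ) / (p + 1) else 0)) := by
    intro a ha
    split_ifs with h
    · obtain ⟨i, hi⟩ := hG a ((hF a).1 ha) h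
      rw [int_ucls_zero G a h i hi]
      have : (p : ℝ) + 1 ≠ 0 := by have := ppos p; positivity
      field_simp; ring
    · rw [int_ucls_unit G a h]; simp
  rw [Finset.sum_congr rfl h1, ← Finset.mul_sum, Finset.sum_sub_distrib, ← Finset.sum_filter]
  have hN : (Set.ncard {a : Fin n → ZMod p | (∀ i, a i ≠ 0) ∧ eval a (redp G) = 0}) =
      (F.filter fun a => eval a (redp G) = 0).card := by
    rw [← Set.ncard_coe_finset]
    congr 1
    ext a; simp [hF]
  have hc : (F.card : ℝ) = ((p : ℝ) - 1) ^ n := by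
    simp only [F, Fintype.card_piFinset, Finset.prod_const, Finset.card_univ, Fintype.card_fin]
    rw [Finset.card_erase_of_mem (Finset.mem_univ _), Finset.card_univ, ZMod.card]
    rw [Nat.cast_pow, Nat.cast_sub (Fact.out : p.Prime).one_le, Nat.cast_one]
  rw [hN]
  simp only [Finset.sum_const, nsmul_eq_mul, mul_one, hc]
  ring

/-- scaling by `p^k` -/
noncomputable def scl (p : ℕ) [Fact p.Prime] (k : Fin n → ℕ) : (Fin n → ℤ_[p]) →+ (Fin n → ℤ_[p]) where
  toFun u := fun i => (p : ℤ_[p]) ^ k i * u i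
  map_zero' := by ext; simp
  map_add' u v := by funext i; simp [mul_add]

lemma scl_range (k : Fin n → ℕ) : Set.range (scl p k) =
    Set.pi Set.univ (fun i => {x : ℤ_[p] | ‖x‖ ≤ (p : ℝ) ^ (-(k i:ℤ))}) := by
  ext x
  simp only [Set.mem_range, Set.mem_pi, Set.mem_univ, true_imp_iff, Set.mem_ofPred_eq, dvd_iff_norm]
  constructor
  · rintro ⟨y, rfl⟩ i; exact ⟨y i, rfl⟩
  · intro h; choose y hy using h; exact ⟨y, funext hy⟩

lemma scl_emb (k : Fin n → ℕ) : Topology.IsOpenEmbedding (scl p k) := by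
  refine openEmb_of _ ?_ ?_ ?_
  · exact continuous_pi fun i => continuous_const.mul (continuous_apply i)
  · intro u v h
    funext i
    exact mul_left_cancel₀ (pow_ne_zero _ pz_ne) (congrFun h i)
  · rw [scl_range]
    exact isOpen_set_pi Set.finite_univ fun i _ => isOpen_ball' _

lemma scl_measure (k : Fin n → ℕ) : (padicHaar p n).real (Set.range (scl p k)) =
    ((p : ℝ)⁻¹) ^ (∑ i, k i) := by
  rw [scl_range, padicHaar_eq_pi, Measure.real, Measure.pi_pi, ENNReal.toReal_prod]
  simp only [nu_ball]
  simp [Finset.prod_pow_eq_pow_sum]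

def shell (p : ℕ) [Fact p.Prime] (k : Fin n → ℕ) : Set (Fin n → ℤ_[p]) :=
  {x | ∀ i, ‖x i‖ = (p : ℝ) ^ (-(k i : ℤ))}

lemma uset_meas : MeasurableSet (uset p n) := by
  have : uset p n = ⋂ i, {u | ‖u i‖ = 1} := by ext; simp [uset]
  rw [this]
  exact MeasurableSet.iInter fun i => (isClosed_eq (by fun_prop) continuous_const).measurableSet

lemma shell_meas (k : Fin n → ℕ) : MeasurableSet (shell p k) := by
  have : shell p k = ⋂ i, {u | ‖u i‖ = (p : ℝ) ^ (-(k i : ℤ))} := by ext; simp [shell]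
  rw [this]
  exact MeasurableSet.iInter fun i => (isClosed_eq (by fun_prop) continuous_const).measurableSet

lemma shell_eq (k : Fin n → ℕ) : shell p k = scl p k '' uset p n := by
  ext x
  constructor
  · intro hx
    have : x ∈ Set.range (scl p k) := by
      rw [scl_range]; intro i _; exact (hx i).le
    obtain ⟨u, rfl⟩ := this
    refine ⟨u, fun i => ?_, rfl⟩
    have h := hx i
    simp only [scl, AddMonoidHom.coe_mk, ZeroHom.coe_mk, norm_mul, PadicInt.norm_p_pow] at h
    exact mul_left_cancel₀ (zpow_ne_zero _ (ppos p).ne') (h.trans (mul_one _).symm)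
  · rintro ⟨u, hu, rfl⟩ i
    simp only [scl, AddMonoidHom.coe_mk, ZeroHom.coe_mk, norm_mul, PadicInt.norm_p_pow, hu i, mul_one]

lemma int_shell (k : Fin n → ℕ) (f : (Fin n → ℤ_[p]) → ℝ) :
    ∫ x in shell p k, f x ∂(padicHaar p n) =
      ((p : ℝ)⁻¹) ^ (∑ i, k i) * ∫ u in uset p n, f (scl p k u) ∂(padicHaar p n) := by
  rw [shell_eq, setIntegral_scale _ _ (scl_emb k) _ _ uset_meas, scl_measure]

end


section
variable {p : ℕ} [Fact p.Prime] {n : ℕ}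

/-- `p^{-m} g(p^k x)` -/
noncomputable def scaledPoly (g : MvPolynomial (Fin n) ℤ_[p]) (k : Fin n → ℕ) (m : ℕ) :
    MvPolynomial (Fin n) ℤ_[p] :=
  ∑ ω ∈ g.support, monomial ω (g.coeff ω * (p : ℤ_[p]) ^ (∑ i, k i * ω i - m))

lemma eval_mono (ω : Fin n →₀ ℕ) (c : ℤ_[p]) (u : Fin n → ℤ_[p]) :
    eval u (monomial ω c) = c * ∏ i, u i ^ ω i := by
  rw [eval_monomial, Finsupp.prod_fintype _ _ (by simp)]

lemma eval_scl (g : MvPolynomial (Fin n) ℤ_[p]) (k : Fin n → ℕ) (m : ℕ)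
    (hm : ∀ ω ∈ g.support, m ≤ ∑ i, k i * ω i) (u : Fin n → ℤ_[p]) :
    eval (scl p k u) g = (p : ℤ_[p]) ^ m * eval u (scaledPoly g k m) := by
  conv_lhs => rw [g.as_sum]
  simp only [scaledPoly, map_sum, Finset.mul_sum]
  refine Finset.sum_congr rfl fun ω hω => ?_
  rw [eval_mono, eval_mono]
  have h1 : ∏ i, (scl p k u i) ^ ω i = (p : ℤ_[p]) ^ (∑ i, k i * ω i) * ∏ i, u i ^ ω i := by
    simp only [scl, AddMonoidHom.coe_mk, ZeroHom.coe_mk, mul_pow, Finset.prod_mul_distrib, ← pow_mul,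
      Finset.prod_pow_eq_pow_sum]
  obtain ⟨d, hd⟩ := Nat.exists_eq_add_of_le (hm ω hω)
  rw [h1, hd, Nat.add_sub_cancel_left, pow_add]
  ring

lemma redp_scaled (g : MvPolynomial (Fin n) ℤ_[p]) (hg : g ≠ 0) (k : Fin n → ℕ) (m : ℕ)
    (hmP : mP (newtonPoly g) (toRn k) = m)
    (hm : ∀ ω ∈ g.support, m ≤ ∑ i, k i * ω i) :
    redp (scaledPoly g k m) = redp (facePoly g (toRn k)) := by
  classical
  simp only [redp, scaledPoly, facePoly, map_sum]
  rw [Finset.sum_filter]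
  refine Finset.sum_congr rfl fun ω hω => ?_
  rw [map_monomial, map_monomial, mem_face_iff g hg k hmP hω]
  split_ifs with h
  · simp [h]
  · have : ∑ i, k i * ω i - m ≠ 0 := by have := hm ω hω; omega
    simp [this]

lemma redp_pderiv (G : MvPolynomial (Fin n) ℤ_[p]) (i : Fin n) :
    redp (pderiv i G) = pderiv i (redp G) := by
  simp only [redp, pderiv_map]

lemma dvd_toZMod (x : ℤ_[p]) : (p : ℤ_[p]) ∣ x ↔ PadicInt.toZMod x = 0 := by
  rw [← PadicInt.norm_lt_one_iff_dvd, norm_lt_one_toZMod]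

lemma nondeg_red {g : MvPolynomial (Fin n) ℤ_[p]} (hnd : NonDeg p g) {k : Fin n → ℝ}
    (hk : k ∈ orthant n) (a : Fin n → ZMod p) (ha : ∀ i, a i ≠ 0)
    (h0 : eval a (redp (facePoly g k)) = 0) :
    ∃ i, eval a (pderiv i (redp (facePoly g k))) ≠ 0 := by
  by_contra! hc
  obtain ⟨b, rfl⟩ := exists_lift a
  refine hnd k hk ⟨b, fun i => ?_, ?_, fun i => ?_⟩
  · rw [PadicInt.isUnit_iff, norm_eq_one_toZMod]; exact ha i
  · rw [dvd_toZMod, toZMod_eval]; exact h0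
  · rw [dvd_toZMod, toZMod_eval, redp_pderiv]; exact hc i

noncomputable def Lk (p : ℕ) [Fact p.Prime] {n : ℕ} (P : MvPolynomial (Fin n) ℤ_[p]) : ℝ :=
  ((p : ℝ)⁻¹) ^ n * (((p : ℝ) - 1) ^ n -
      (Set.ncard {a : Fin n → ZMod p | (∀ i, a i ≠ 0) ∧ eval a (redp P) = 0}) * (p : ℝ) / (p + 1))

lemma int_shell_g {g : MvPolynomial (Fin n) ℤ_[p]} (hg : g ≠ 0) (hnd : NonDeg p g) (k : Fin n → ℕ)
    (m : ℕ) (hmP : mP (newtonPoly g) (toRn k) = m)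
    (hm : ∀ ω ∈ g.support, m ≤ ∑ i, k i * ω i) :
    ∫ x in shell p k, ‖eval x g‖ ∂(padicHaar p n) =
      ((p : ℝ)⁻¹) ^ (∑ i, k i) * ((p : ℝ)⁻¹) ^ m * Lk p (facePoly g (toRn k)) := by
  rw [int_shell]
  simp only [eval_scl g k m hm, norm_mul, norm_pow, PadicInt.norm_p]
  rw [integral_const_mul, int_units, Lk, redp_scaled g hg k m hmP hm, mul_assoc]
  intro a ha h0
  simp only [redp_pderiv]
  rw [redp_scaled g hg k m hmP hm] at *
  exact nondeg_red hnd (toRn_nonneg k) a ha h0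

lemma shell_norm (k : Fin n → ℕ) {x : Fin n → ℤ_[p]} (hx : x ∈ shell p k) (ω : Fin n →₀ ℕ) :
    ‖∏ i, x i ^ ω i‖ = ((p : ℝ)⁻¹) ^ (∑ i, k i * ω i) := by
  rw [norm_prod]
  have : ∀ i, ‖x i‖ = ((p : ℝ)⁻¹) ^ k i := fun i => by rw [hx i]; simp
  simp only [norm_pow, this, ← pow_mul, Finset.prod_pow_eq_pow_sum]

lemma idealNorm_shell {I : Ideal (MvPolynomial (Fin n) ℤ_[p])}
    (hImono : ∃ S : Set (Fin n →₀ ℕ), I = Ideal.span ((fun ω => monomial ω (1 : ℤ_[p])) '' S))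
    (k : Fin n → ℕ) (m : ℕ) (h1 : ∀ ω ∈ expSet I, m ≤ ∑ i, k i * ω i)
    (h2 : ∃ ω ∈ expSet I, m = ∑ i, k i * ω i) {x : Fin n → ℤ_[p]} (hx : x ∈ shell p k) :
    idealNorm I x = ((p : ℝ)⁻¹) ^ m := by
  have hle : IsGreatest ((fun f => ‖eval x f‖) '' (I : Set (MvPolynomial (Fin n) ℤ_[p])))
      (((p : ℝ)⁻¹) ^ m) := by
    constructor
    · obtain ⟨ω, hω, rfl⟩ := h2
      refine ⟨_, hω, ?_⟩
      simp only [eval_mono, one_mul, shell_norm k hx]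
    · rintro _ ⟨f, hf, rfl⟩
      dsimp only
      rw [f.as_sum, map_sum]
      refine IsUltrametricDist.norm_sum_le_of_forall_le_of_nonneg
        (pow_nonneg (inv_nonneg.2 (ppos p).le) _) fun ω hω => ?_
      rw [eval_mono, norm_mul, shell_norm k hx]
      calc _ ≤ 1 * ((p : ℝ)⁻¹) ^ (∑ i, k i * ω i) := by
            gcongr; exact PadicInt.norm_le_one _
        _ ≤ _ := by
            rw [one_mul]
            exact pow_le_pow_of_le_one (inv_nonneg.2 (ppos p).le)
              (inv_le_one_of_one_le₀ (pgt1 p).le) (h1 ω (mem_expSet_of_support hImono hf hω))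
  exact hle.csSup_eq

lemma shell_disj : Pairwise (Function.onFun Disjoint (fun k : Fin n → ℕ => shell p k)) := by
  intro k k' hkk
  refine Set.disjoint_left.2 fun x hx hx' => hkk ?_
  funext i
  have h := (hx i).symm.trans (hx' i)
  have := zpow_right_injective₀ (ppos p) (pgt1 p).ne' h
  omega

lemma shell_union : (⋃ k : Fin n → ℕ, shell p k) =ᵐ[padicHaar p n] Set.univ := by
  rw [ae_eq_univ]
  have hsub : (⋃ k : Fin n → ℕ, shell p k)ᶜ ⊆ ⋃ i, {x : Fin n → ℤ_[p] | x i = 0} := by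
    intro x hx
    by_contra hc
    simp only [Set.mem_iUnion, Set.mem_ofPred_eq, not_exists] at hc
    apply hx
    exact Set.mem_iUnion.2 ⟨fun i => (x i).valuation, fun i =>
      PadicInt.norm_eq_zpow_neg_valuation (hc i)⟩
  refine measure_mono_null hsub (measure_iUnion_null fun i => ?_)
  rw [padicHaar_eq_pi]
  exact Measure.pi_hyperplane _ i 0

lemma summable_sigma : Summable (fun k : Fin n → ℕ => ((p : ℝ)⁻¹) ^ (∑ i, k i)) := by
  have h := (hasSum_integral_iUnion (μ := padicHaar p n) (f := fun _ => (1 : ℝ))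
    (shell_meas (p := p) (n := n)) shell_disj (integrable_const _).integrableOn).summable
  have hU : ∫ u in uset p n, (1 : ℝ) ∂(padicHaar p n) ≠ 0 := by
    have := int_units (p := p) (n := n) 1 (by intro a _ h; simp [redp] at h)
    simp [redp] at this
    have h2 : ((p:ℝ) - 1) ≠ 0 := by have := pgt1 p; intro h; linarith
    have hp0 : (p:ℝ) ≠ 0 := (ppos p).ne'
    simp [this, h2, hp0]
  simp only [int_shell] at h
  exact (summable_mul_right_iff hU).1 h

lemma real_cpow (m : ℕ) (s : ℂ) : ((((p : ℝ)⁻¹) ^ m : ℝ) : ℂ) ^ s = (p : ℂ) ^ (-(m : ℂ) * s) := by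
  have hp0 : (p:ℂ) ≠ 0 := by exact_mod_cast (Fact.out : p.Prime).ne_zero
  have hx : (0:ℝ) < ((p : ℝ)⁻¹) ^ m := pow_pos (inv_pos.2 (ppos p)) _
  rw [Complex.cpow_def_of_ne_zero (by exact_mod_cast hx.ne'), Complex.cpow_def_of_ne_zero hp0,
    ← Complex.ofReal_log hx.le, Real.log_pow, Real.log_inv]
  congr 1
  push_cast
  rw [← Complex.natCast_log]
  push_cast
  ring

lemma Sterm_eq {I : Ideal (MvPolynomial (Fin n) ℤ_[p])} {g : MvPolynomial (Fin n) ℤ_[p]}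
    (s : ℂ) (k : Fin n → ℕ) {mI m : ℕ} (hI : mP (newtonPolyIdeal I) (toRn k) = mI)
    (hm : mP (newtonPoly g) (toRn k) = m) :
    Sterm p I g s k = ((((p : ℝ)⁻¹) ^ mI : ℝ) : ℂ) ^ s *
      ((((p : ℝ)⁻¹) ^ (∑ i, k i) * ((p : ℝ)⁻¹) ^ m : ℝ) : ℂ) := by
  have hp0 : (p:ℂ) ≠ 0 := by exact_mod_cast (Fact.out : p.Prime).ne_zero
  rw [Sterm, hI, hm, sigmaFn, Complex.cpow_sub _ _ hp0, Complex.cpow_sub _ _ hp0, real_cpow]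
  have : ((∑ i, (k i : ℝ) : ℝ) : ℂ) = ((∑ i, k i : ℕ) : ℂ) := by push_cast; rfl
  rw [this, Complex.ofReal_natCast, Complex.cpow_natCast, Complex.ofReal_natCast,
    Complex.cpow_natCast]
  push_cast
  simp only [inv_pow]
  field_simp

lemma norm_cpow_le (m : ℕ) (s : ℂ) (hs : 0 < s.re) : ‖((((p : ℝ)⁻¹) ^ m : ℝ) : ℂ) ^ s‖ ≤ 1 := by
  have hx : (0:ℝ) < ((p : ℝ)⁻¹) ^ m := pow_pos (inv_pos.2 (ppos p)) _
  rw [Complex.norm_cpow_eq_rpow_re_of_pos hx]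
  exact Real.rpow_le_one hx.le (pow_le_one₀ (inv_nonneg.2 (ppos p).le)
              (inv_le_one_of_one_le₀ (pgt1 p).le)) hs.le

lemma facePoly_congr (g : MvPolynomial (Fin n) ℤ_[p]) {k k' : Fin n → ℝ}
    (h : faceOf (newtonPoly g) k = faceOf (newtonPoly g) k') : facePoly g k = facePoly g k' := by
  unfold facePoly; rw [h]

lemma Ldelta_eq {I : Ideal (MvPolynomial (Fin n) ℤ_[p])} {g : MvPolynomial (Fin n) ℤ_[p]}
    {δ : Set (Fin n → ℝ)} (hδ : δ ∈ DIg I g) {k : Fin n → ℝ} (hk : k ∈ δ) :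
    Ldelta p g δ = ((Lk p (facePoly g k) : ℝ) : ℂ) := by
  have hne : δ.Nonempty := ⟨k, hk⟩
  have hc : conePoly g δ = facePoly g k := by
    rw [conePoly, dif_pos hne]
    apply facePoly_congr
    have h1 := hne.some_mem
    obtain ⟨k0, -, h⟩ := hδ
    generalize hne.some = y at *
    subst h
    exact h1.2.2.trans hk.2.2.symm
  rw [Ldelta, Ndelta, hc, Lk]
  push_cast
  rw [zpow_neg, zpow_natCast, inv_pow]

end

/-- **Theorem (Igusa's zeta function of a monomial ideal and a polynomial measure).**
For a nonzero proper monomial ideal `I` of `ℤ_p[x_1,…,x_n]` and a nonzero `g` with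
`g(0) = 0` that is non-degenerated over `𝔽_p` w.r.t. its Newton polyhedron, for
`Re(s) > 0` the series `S_δ(s)` converge absolutely and
`Z_{I,g}(s) = ∫_{ℤ_p^n} |I(x)|^s |g(x)| dμ = Σ_{δ ∈ D_{I,g}} L_δ S_δ(s)`
(the partition `D_{I,g}` being finite). -/
theorem igusa_zeta_monomial_ideal_poly_measure (p : ℕ) [Fact p.Prime] (n : ℕ) (hn : 1 ≤ n)
    (I : Ideal (MvPolynomial (Fin n) ℤ_[p]))
    (hInz : I ≠ ⊥) (hIproper : I ≠ ⊤)
    (hImono : ∃ S : Set (Fin n →₀ ℕ), I = Ideal.span ((fun ω => monomial ω (1 : ℤ_[p])) '' S))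
    (g : MvPolynomial (Fin n) ℤ_[p]) (hg : g ≠ 0) (hg0 : g.coeff 0 = 0)
    (hndg : NonDeg p g)
    (s : ℂ) (hs : 0 < s.re) :
    (DIg I g).Finite ∧
    (∀ δ ∈ DIg I g,
      Summable (fun k : {k : Fin n → ℕ // toRn k ∈ δ} => ‖Sterm p I g s k‖)) ∧
    ∫ x, (idealNorm I x : ℂ) ^ s * (‖eval x g‖ : ℂ) ∂(padicHaar p n)
      = ∑' δ : DIg I g, Ldelta p g δ * Sdelta p I g δ s := by
  have hA := expSet_nonempty hInz hImono
  choose mI hI1 hI2 hI3 using mP_ideal hA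
  choose m hm1 hm2 using mP_poly g hg
  have hp1 : (p:ℝ)⁻¹ ≤ 1 := inv_le_one_of_one_le₀ (pgt1 p).le
  have hp0 : 0 ≤ (p:ℝ)⁻¹ := inv_nonneg.2 (ppos p).le
  have hsum : Summable (fun k : Fin n → ℕ => ‖Sterm p I g s k‖) := by
    refine Summable.of_nonneg_of_le (fun _ => norm_nonneg _) (fun k => ?_)
      (summable_sigma (p := p) (n := n))
    rw [Sterm_eq s k (hI1 k) (hm1 k), norm_mul, Complex.norm_real, norm_mul,
      Real.norm_of_nonneg (pow_nonneg hp0 _), Real.norm_of_nonneg (pow_nonneg hp0 _)]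
    calc _ ≤ 1 * (((p : ℝ)⁻¹) ^ (∑ i, k i) * 1) := by
          gcongr
          · exact norm_cpow_le _ _ hs
          · exact pow_le_one₀ hp0 hp1
      _ = _ := by ring
  refine ⟨DIg_finite hA hg, fun δ _ => hsum.comp_injective Subtype.val_injective, ?_⟩
  set f : (Fin n → ℤ_[p]) → ℂ := fun x => (idealNorm I x : ℂ) ^ s * (‖eval x g‖ : ℂ) with hf
  have hfs : ∀ k, ∀ x ∈ shell p k, f x = ((((p : ℝ)⁻¹) ^ mI k : ℝ) : ℂ) ^ s * (‖eval x g‖ : ℂ) := by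
    intro k x hx
    rw [hf]
    dsimp only
    rw [idealNorm_shell hImono k (mI k) (hI2 k) (hI3 k) hx]
  have hint : IntegrableOn f (⋃ k : Fin n → ℕ, shell p k) (padicHaar p n) := by
    refine Measure.integrableOn_of_bounded (M := 1) (measure_ne_top _ _) ?_ ?_
    · rw [← Measure.restrict_univ (μ := padicHaar p n),
        ← Measure.restrict_congr_set (shell_union (p := p) (n := n)), aestronglyMeasurable_iUnion_iff]
      intro k
      have hc : Continuous (fun x : Fin n → ℤ_[p] =>
          ((((p : ℝ)⁻¹) ^ mI k : ℝ) : ℂ) ^ s * (‖eval x g‖ : ℂ)) :=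
        continuous_const.mul (Complex.continuous_ofReal.comp (cont_eval g))
      refine hc.aestronglyMeasurable.congr ?_
      exact ae_restrict_of_forall_mem (shell_meas k) fun x hx => (hfs k x hx).symm
    · refine ae_restrict_of_forall_mem (MeasurableSet.iUnion shell_meas) fun x hx => ?_
      obtain ⟨k, hk⟩ := Set.mem_iUnion.1 hx
      rw [hfs k x hk, norm_mul, Complex.norm_real, norm_norm]
      exact mul_le_one₀ (norm_cpow_le _ _ hs) (norm_nonneg _) (PadicInt.norm_le_one _)
  have hHS := hasSum_integral_iUnion (shell_meas (p := p) (n := n)) shell_disj hint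
  rw [setIntegral_congr_set shell_union, setIntegral_univ] at hHS
  have hterm : ∀ k, ∫ x in shell p k, f x ∂(padicHaar p n) =
      (Lk p (facePoly g (toRn k)) : ℂ) * Sterm p I g s k := by
    intro k
    rw [setIntegral_congr_fun (shell_meas k) (hfs k), integral_const_mul, integral_complex_ofReal,
      int_shell_g hg hndg k (m k) (hm1 k) (hm2 k), Sterm_eq s k (hI1 k) (hm1 k)]
    push_cast
    ring
  simp only [hterm] at hHS
  let κ : (Fin n → ℕ) → DIg I g := fun k => ⟨_, toRn k, toRn_nonneg k, rfl⟩
  have hκ : ∀ k δ, κ k = δ ↔ toRn k ∈ δ.1 := by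
    intro k δ
    constructor
    · rintro rfl
      exact ⟨toRn_nonneg k, rfl, rfl⟩
    · intro h
      obtain ⟨δ, k0, hk0, rfl⟩ := δ
      apply Subtype.ext
      simp only [κ, h.2.1, h.2.2]
  have h3 := (hHS.tsum_fiberwise κ).tsum_eq
  rw [← h3]
  refine tsum_congr fun δ => ?_
  rw [Sdelta, ← tsum_mul_left]
  rw [← (Equiv.subtypeEquivRight (fun k => (hκ k δ))).tsum_eq]
  refine tsum_congr fun k => ?_
  have hk : toRn k.1 ∈ δ.1 := (hκ _ _).1 k.2
  rw [Ldelta_eq δ.2 hk]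
  rfl
end

section
/- Let p be a prime, n ≥ 2, and f, g ∈ ℤ_p[x_1,…,x_n]. Let a ∈ ℤ_p^n be a solution of none of the following three systems of congruences: (1) f(x) ≡ 0 and ∂f/∂x_i(x) ≡ 0 mod p for i = 1,…,n; (2) g(x) ≡ 0 and ∂g/∂x_i(x) ≡ 0 mod p for i = 1,…,n; (3) f(x) ≡ 0, g(x) ≡ 0, and (∂f/∂x_i · ∂g/∂x_j − ∂f/∂x_j · ∂g/∂x_i)(x) ≡ 0 mod p for all 1 ≤ i < j ≤ n. Then for every complex s with Re(s) > 0: ∫_{a+(pℤ_p)^n} |f(x)|^s |g(x)| dμ equals p^{-n} if f(a) ≢ 0 and g(a) ≢ 0 mod p; equals p^{-n}(p−1)/(p^{s+1}−1) if f(a) ≡ 0 and g(a) ≢ 0 mod p; equals p^{-n}/(p+1) if f(a) ≢ 0 and g(a) ≡ 0 mod p; and equals p^{-n}(p−1)/((p^{s+1}−1)(p+1)) if f(a) ≡ 0 and g(a) ≡ 0 mod p. -/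
open MeasureTheory MvPolynomial

/-- The coset `a + (pℤ_p)^n`. -/
def coset (p : ℕ) [Fact p.Prime] {n : ℕ} (a : Fin n → ℤ_[p]) : Set (Fin n → ℤ_[p]) :=
  {x | ∀ i, (p : ℤ_[p]) ∣ (x i - a i)}


namespace PadicAux

variable (p : ℕ) [Fact p.Prime]
noncomputable def mu1 : Measure ℤ_[p] := Measure.addHaarMeasure ⟨⟨Set.univ, isCompact_univ⟩, by simp⟩
instance : (mu1 p).IsAddHaarMeasure := by unfold mu1; infer_instance
instance : IsProbabilityMeasure (mu1 p) := ⟨by unfold mu1; exact Measure.addHaarMeasure_self⟩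
instance (n) : (padicHaar p n).IsAddHaarMeasure := by unfold padicHaar; infer_instance
instance (n) : IsProbabilityMeasure (padicHaar p n) := ⟨by unfold padicHaar; exact Measure.addHaarMeasure_self⟩

lemma padicHaar_eq (n : ℕ) : padicHaar p n = Measure.pi (fun _ => mu1 p) :=
  Measure.isAddHaarMeasure_eq_of_isProbabilityMeasure _ _

lemma mu1_p : mu1 p {x | (p:ℤ_[p]) ∣ x} = (p:ENNReal)⁻¹ := by
  have hk : ((PadicInt.toZMod (p := p)).toAddMonoidHom.ker : Set ℤ_[p]) = {x | (p:ℤ_[p]) ∣ x} := by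
    ext x
    have : x ∈ RingHom.ker (PadicInt.toZMod (p := p)) ↔ (p:ℤ_[p]) ∣ x := by
      rw [PadicInt.ker_toZMod, PadicInt.maximalIdeal_eq_span_p, Ideal.mem_span_singleton]
    exact this
  have hi : (PadicInt.toZMod (p := p)).toAddMonoidHom.ker.index = p := by
    rw [AddSubgroup.index_ker, AddMonoidHom.range_eq_top.2 (ZMod.ringHom_surjective PadicInt.toZMod)]
    simp
  have : (PadicInt.toZMod (p := p)).toAddMonoidHom.ker.FiniteIndex := 
    ⟨by rw [hi]; exact (Fact.out : p.Prime).ne_zero⟩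
  have hm : MeasurableSet {x | (p:ℤ_[p]) ∣ x} := by
    simp_rw [← PadicInt.norm_lt_one_iff_dvd]
    exact (isOpen_lt continuous_norm continuous_const).measurableSet
  have h := (PadicInt.toZMod (p := p)).toAddMonoidHom.ker.index_mul_measure (hk ▸ hm) (mu1 p)
  rw [hi, hk, measure_univ, mul_comm] at h
  exact ENNReal.eq_inv_of_mul_eq_one_left h

lemma scale {G : Type*} [AddCommGroup G] [TopologicalSpace G] [IsTopologicalAddGroup G] [CompactSpace G]
   [SecondCountableTopology G] [T2Space G] [MeasurableSpace G] [BorelSpace G] (μ : Measure G) [μ.IsAddHaarMeasure] [IsProbabilityMeasure μ] 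
   (φ : G →+ G) (hc : Continuous φ) (hi : Function.Injective φ) : 
   μ.restrict (Set.range φ) = μ (Set.range φ) • Measure.map φ μ := by
  have hφ : MeasurableEmbedding φ := (hc.isClosedEmbedding hi).measurableEmbedding
  have := Measure.IsAddLeftInvariant.comap μ hφ
  have : IsFiniteMeasure (μ.comap φ) := ⟨by rw [hφ.comap_apply]; exact measure_lt_top _ _⟩
  obtain ⟨c, h1⟩ : ∃ c : NNReal, μ.comap φ = c • μ := ⟨_, Measure.isAddLeftInvariant_eq_smul (μ.comap φ) μ⟩
  have h2 := congrArg (fun ν => ν Set.univ) h1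
  simp only [hφ.comap_apply, Set.image_univ, Measure.smul_apply, measure_univ] at h2
  rw [← hφ.map_comap, h2, h1, Measure.map_smul]
  ext s hs
  simp

lemma mu1_scale (F : ℤ_[p] → ℂ) : ∫ x in {x | (p:ℤ_[p]) ∣ x}, F x ∂(mu1 p) = (p:ℂ)⁻¹ * ∫ x, F (p * x) ∂(mu1 p) := by
  have hp : (p:ℤ_[p]) ≠ 0 := by exact_mod_cast (Fact.out : p.Prime).ne_zero
  have hc : Continuous (AddMonoidHom.mulLeft (p:ℤ_[p])) := continuous_const.mul continuous_id
  have hi : Function.Injective (AddMonoidHom.mulLeft (p:ℤ_[p])) := mul_right_injective₀ hp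
  have hr : Set.range (AddMonoidHom.mulLeft (p:ℤ_[p])) = {x | (p:ℤ_[p]) ∣ x} := by
    ext x; exact ⟨fun ⟨y, hy⟩ => ⟨y, hy.symm⟩, fun ⟨y, hy⟩ => ⟨y, hy.symm⟩⟩
  have h := scale (mu1 p) _ hc hi
  rw [hr, mu1_p] at h
  rw [h, integral_smul_measure, (hc.isClosedEmbedding hi).measurableEmbedding.integral_map]
  simp

lemma coset_meas {n : ℕ} (a : Fin n → ℤ_[p]) : MeasurableSet (coset p a) := by
  unfold coset
  simp_rw [← PadicInt.norm_lt_one_iff_dvd]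
  rw [Set.ofPred_forall]
  exact MeasurableSet.iInter fun i => (isOpen_lt (by fun_prop) continuous_const).measurableSet

lemma haar_coset0 (n : ℕ) : padicHaar p n (coset p 0) = ((p:ENNReal)⁻¹)^n := by
  have : coset p (0 : Fin n → ℤ_[p]) = Set.univ.pi fun _ => {x | (p:ℤ_[p]) ∣ x} := by
    ext x; simp [coset]
  rw [this, padicHaar_eq, Measure.pi_pi]
  simp [mu1_p]

lemma coset_int {n : ℕ} (a : Fin n → ℤ_[p]) (F : (Fin n → ℤ_[p]) → ℂ) :
    ∫ x in coset p a, F x ∂(padicHaar p n) = (p:ℂ)^(-(n:ℤ)) * ∫ u, F (fun k => a k + p * u k) ∂(padicHaar p n) := by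
  have hp : (p:ℤ_[p]) ≠ 0 := by exact_mod_cast (Fact.out : p.Prime).ne_zero
  let φ : (Fin n → ℤ_[p]) →+ (Fin n → ℤ_[p]) := AddMonoidHom.mulLeft (fun _ => (p:ℤ_[p]))
  have hc : Continuous φ := continuous_const.mul continuous_id
  have hi : Function.Injective φ := by
    intro x y h
    ext1 k
    exact mul_right_injective₀ hp (congrFun h k)
  have hr : Set.range φ = coset p 0 := by
    ext x
    constructor
    · rintro ⟨y, rfl⟩ k
      exact ⟨y k, by simp [φ]⟩
    · intro h
      choose y hy using h
      exact ⟨y, by ext1 k; simpa [φ] using (hy k).symm⟩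
  have h := scale (padicHaar p n) _ hc hi
  rw [hr, haar_coset0] at h
  rw [← integral_indicator (coset_meas p a), ← integral_add_left_eq_self _ a]
  have : (fun x => (coset p a).indicator F (a + x)) = (coset p 0).indicator (fun x => F (a + x)) := by
    ext x
    have : a + x ∈ coset p a ↔ x ∈ coset p 0 := by simp [coset]
    by_cases hxx : x ∈ coset p 0
    · rw [Set.indicator_of_mem hxx, Set.indicator_of_mem (this.2 hxx)]
    · rw [Set.indicator_of_notMem hxx, Set.indicator_of_notMem (fun h => hxx (this.1 h))]
  rw [this, integral_indicator (coset_meas p 0), h, integral_smul_measure, (hc.isClosedEmbedding hi).measurableEmbedding.integral_map]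
  simp
  left
  rfl

lemma norm_le_of_dvd {n : ℕ} (w w' : Fin n → ℤ_[p]) (h : ∀ d, (∀ k, d ∣ w k) → ∀ k, d ∣ w' k) : ‖w'‖ ≤ ‖w‖ := by
  rw [pi_norm_le_iff_of_nonneg (norm_nonneg _)]
  intro k
  have : Nonempty (Fin n) := ⟨k⟩
  obtain ⟨k0, hk0⟩ := Finite.exists_max (fun k => ‖w k‖)
  have hd : ∀ d e : ℤ_[p], d ∣ e → ‖e‖ ≤ ‖d‖ := by
    rintro d e ⟨c, rfl⟩
    rw [norm_mul]
    exact mul_le_of_le_one_right (norm_nonneg _) (PadicInt.norm_le_one c)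
  refine (hd _ _ (h (w k0) (fun j => ?_) k)).trans (norm_le_pi_norm w k0)
  by_cases h0 : w k0 = 0
  · have := hk0 j
    rw [h0, norm_zero, norm_le_zero_iff] at this
    rw [this]; exact dvd_zero _
  rcases ValuationRing.dvd_total (w k0) (w j) with h1 | ⟨c, hc⟩
  · exact h1
  · have h2 := hk0 j
    rw [hc, norm_mul] at h2
    have hj : 0 < ‖w j‖ := by
      rw [norm_pos_iff]; rintro h3; simp [h3] at hc; exact h0 hc
    have h3 : ‖c‖ = 1 := le_antisymm (PadicInt.norm_le_one c) (le_of_mul_le_mul_left (by simpa using h2) hj)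
    rw [hc]
    exact (PadicInt.isUnit_iff.2 h3).mul_right_dvd.2 dvd_rfl

lemma surj_of_isom {X : Type*} [MetricSpace X] [CompactSpace X] (T : X → X) (hT : Isometry T) : Function.Surjective T := by
  by_contra hc
  simp only [Function.Surjective, not_forall] at hc
  obtain ⟨y, hy⟩ := hc
  have hcl : IsClosed (Set.range T) := (isCompact_range hT.continuous).isClosed
  obtain ⟨δ, hδ, hb⟩ := Metric.isOpen_iff.1 hcl.isOpen_compl y hy
  have hd : ∀ x, δ ≤ dist (T x) y := by
    intro x
    by_contra h
    exact hb (Metric.mem_ball.2 (not_le.1 h)) ⟨x, rfl⟩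
  have hit : ∀ m, Isometry (T^[m]) := fun m => by
    induction m with
    | zero => exact isometry_id
    | succ m ih => exact ih.comp hT
  have hdd : ∀ m k, δ ≤ dist (T^[m+k+1] y) (T^[m] y) := by
    intro m k
    rw [add_assoc, Function.iterate_add_apply, (hit m).dist_eq, Function.iterate_succ_apply']
    exact hd _
  obtain ⟨a, φ, hφ, ha⟩ := CompactSpace.tendsto_subseq (fun m => T^[m] y)
  have hc := ha.cauchySeq
  obtain ⟨N, hN⟩ := Metric.cauchySeq_iff.1 hc δ hδ
  have h1 := hN (N+1) (by omega) N le_rfl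
  have h2 : φ N < φ (N+1) := hφ (by omega)
  have h3 := hdd (φ N) (φ (N+1) - φ N - 1)
  rw [show φ N + (φ (N+1) - φ N - 1) + 1 = φ (N+1) by omega] at h3
  simp only [Function.comp] at h1
  linarith

lemma map_isom {G : Type*} [NormedAddCommGroup G] [IsUltrametricDist G] [CompactSpace G]
   [SecondCountableTopology G] [MeasurableSpace G] [BorelSpace G] (μ : Measure G) [μ.IsAddHaarMeasure] [IsProbabilityMeasure μ] 
   (T : G → G) (hT : Isometry T) : Measure.map T μ = μ := by
  have hm : Measurable T := hT.continuous.measurable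
  have : IsProbabilityMeasure (Measure.map T μ) := Measure.isProbabilityMeasure_map hm.aemeasurable
  have hb : TopologicalSpace.IsTopologicalBasis {s : Set G | ∃ x r, s = Metric.ball x r} := by
    apply TopologicalSpace.isTopologicalBasis_of_isOpen_of_nhds
    · rintro _ ⟨x, r, rfl⟩; exact Metric.isOpen_ball
    · intro a u ha hu
      obtain ⟨ε, h, h'⟩ := Metric.isOpen_iff.1 hu a ha
      exact ⟨_, ⟨a, ε, rfl⟩, Metric.mem_ball_self h, h'⟩
  apply ext_of_generate_finite {s : Set G | ∃ x r, s = Metric.ball x r}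
  · rw [BorelSpace.measurable_eq (α := G), hb.borel_eq_generateFrom]
  · rintro _ ⟨x, r, rfl⟩ _ ⟨y, s, rfl⟩ hne
    rcases IsUltrametricDist.ball_subset_trichotomy x y r s with h | h | h
    · exact ⟨x, r, Set.inter_eq_left.2 h⟩
    · exact ⟨y, s, Set.inter_eq_right.2 h⟩
    · exact absurd hne (Set.not_nonempty_iff_eq_empty.2 h.inter_eq)
  · rintro _ ⟨y, r, rfl⟩
    obtain ⟨x, rfl⟩ := surj_of_isom T hT y
    rw [Measure.map_apply hm Metric.isOpen_ball.measurableSet, hT.preimage_ball]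
    have key : ∀ x : G, μ (Metric.ball x r) = μ (Metric.ball 0 r) := fun x => by
      have : Metric.ball (0:G) r = (x + ·) ⁻¹' Metric.ball x r := by simp [preimage_add_ball]
      rw [this, measure_preimage_add]
    rw [key, key (T x)]
  · simp

lemma poly_diff {n : ℕ} (a x y : Fin n → ℤ_[p]) (hx : ∀ i, (p : ℤ_[p]) ∣ x i - a i) (hy : ∀ i, (p : ℤ_[p]) ∣ y i - a i)
   (f : MvPolynomial (Fin n) ℤ_[p]) : ((p : ℤ_[p]) ∣ eval x f - eval a f) ∧ ((p : ℤ_[p]) ∣ eval y f - eval a f) ∧ 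
    ∃ D : Fin n → ℤ_[p], eval x f - eval y f = ∑ i, D i * (x i - y i) ∧
     ∀ i, (p : ℤ_[p]) ∣ D i - eval a (pderiv i f) := by
  induction f using MvPolynomial.induction_on with
  | C c => exact ⟨by simp, by simp, 0, by simp, by simp⟩
  | add f g hf hg =>
    obtain ⟨f1, f2, D, hD, hD'⟩ := hf
    obtain ⟨g1, g2, E, hE, hE'⟩ := hg
    refine ⟨?_, ?_, D + E, ?_, fun i => ?_⟩
    · convert dvd_add f1 g1 using 1; simp; ring
    · convert dvd_add f2 g2 using 1; simp; ring
    · simp only [map_add, Pi.add_apply, add_mul, Finset.sum_add_distrib, ← hD, ← hE]; ring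
    · convert dvd_add (hD' i) (hE' i) using 1; simp; ring
  | mul_X f j hf =>
    obtain ⟨f1, f2, D, hD, hD'⟩ := hf
    refine ⟨?_, ?_, fun i => D i * x j + if i = j then eval y f else 0, ?_, fun i => ?_⟩
    · convert dvd_add (f1.mul_right (x j)) ((hx j).mul_right (eval a f)) using 1; simp; ring
    · convert dvd_add (f2.mul_right (y j)) ((hy j).mul_right (eval a f)) using 1; simp; ring
    · have : ∑ i, D i * x j * (x i - y i) = (eval x f - eval y f) * x j := by
        rw [hD, Finset.sum_mul]; exact Finset.sum_congr rfl fun i _ => by ring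
      simp only [add_mul, Finset.sum_add_distrib, this, ite_mul, zero_mul, Finset.sum_ite_eq', Finset.mem_univ, if_true]
      simp; ring
    · have := dvd_add ((hD' i).mul_right (x j)) ((hx j).mul_right (eval a (pderiv i f)))
      rcases eq_or_ne i j with rfl | h
      · convert dvd_add this f2 using 1; simp [pderiv_X]; ring
      · convert this using 1; simp [pderiv_X, h, h.symm]; ring

lemma lin_dvd {n : ℕ} {i j : Fin n} (hij : i ≠ j) (A B w : Fin n → ℤ_[p]) (d : ℤ_[p])
   (hu : IsUnit (A i * B j - A j * B i)) (hw : ∀ k, k ≠ i → k ≠ j → d ∣ w k)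
   (hA : d ∣ ∑ k, A k * w k) (hB : d ∣ ∑ k, B k * w k) : ∀ k, d ∣ w k := by
  have key : ∀ C : Fin n → ℤ_[p], d ∣ ∑ k, C k * w k → d ∣ C i * w i + C j * w j := by
    intro C hC
    rw [← Finset.add_sum_erase _ _ (Finset.mem_univ i), ← Finset.add_sum_erase _ _ (Finset.mem_erase.2 ⟨hij.symm, Finset.mem_univ j⟩), ← add_assoc] at hC
    refine (dvd_add_left (Finset.dvd_sum fun k hk => ?_)).1 hC
    simp only [Finset.mem_erase] at hk
    exact (hw k hk.2.1 hk.1).mul_left _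
  have a1 := key A hA
  have b1 := key B hB
  have hi : d ∣ w i := by
    rw [← hu.dvd_mul_left (a := d) (b := w i)] 
    convert dvd_sub (a1.mul_left (B j)) (b1.mul_left (A j)) using 1; ring
  have hj : d ∣ w j := by
    rw [← hu.dvd_mul_left (a := d) (b := w j)] 
    convert dvd_sub (b1.mul_left (A i)) (a1.mul_left (B i)) using 1; ring
  intro k
  by_cases h : k = i
  · exact h ▸ hi
  by_cases h' : k = j
  · exact h' ▸ hj
  exact hw k h h'

lemma isUnit_of_not_dvd {x : ℤ_[p]} (h : ¬ (p:ℤ_[p]) ∣ x) : IsUnit x := by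
  by_contra h'
  exact h ((PadicInt.norm_lt_one_iff_dvd x).1 (PadicInt.not_isUnit_iff.1 h'))

lemma main_int {n : ℕ} (f g : MvPolynomial (Fin n) ℤ_[p]) (a : Fin n → ℤ_[p]) {i j : Fin n} (hij : i ≠ j)
    (hf : (p : ℤ_[p]) ∣ eval a f) (hg : (p : ℤ_[p]) ∣ eval a g)
    (hu : ¬ (p : ℤ_[p]) ∣ eval a (pderiv i f * pderiv j g - pderiv j f * pderiv i g))
    (h1 h2 : ℤ_[p] → ℂ) (hm1 : Measurable h1) (hm2 : Measurable h2) :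
    ∫ x in coset p a, h1 (eval x f) * h2 (eval x g) ∂(padicHaar p n) =
     (p:ℂ)^(-(n:ℤ)) * ((∫ y, h1 (p * y) ∂(mu1 p)) * (∫ y, h2 (p * y) ∂(mu1 p))) := by
  have hp : (p:ℤ_[p]) ≠ 0 := by exact_mod_cast (Fact.out : p.Prime).ne_zero
  rw [coset_int]
  congr 1
  have hx : ∀ u : Fin n → ℤ_[p], ∀ k, (p:ℤ_[p]) ∣ (fun k => a k + p * u k) k - a k := fun u k => by simp
  have ef : ∀ u : Fin n → ℤ_[p], ∃ v, eval (fun k => a k + p * u k) f = p * v := fun u =>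
    (dvd_sub_left hf).1 (poly_diff p a _ _ (hx u) (hx u) f).1
  have eg : ∀ u : Fin n → ℤ_[p], ∃ v, eval (fun k => a k + p * u k) g = p * v := fun u =>
    (dvd_sub_left hg).1 (poly_diff p a _ _ (hx u) (hx u) g).1
  choose qf hqf using ef
  choose qg hqg using eg
  let T : (Fin n → ℤ_[p]) → (Fin n → ℤ_[p]) := fun u k => if k = i then qf u else if k = j then qg u else u k
  have Ti : ∀ u, T u i = qf u := fun u => by simp [T]
  have Tj : ∀ u, T u j = qg u := fun u => by simp [T, hij.symm]
  have Tk : ∀ u k, k ≠ i → k ≠ j → T u k = u k := fun u k h h' => by simp [T, h, h']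
  have hT : Isometry T := by
    apply Isometry.of_dist_eq
    intro u v
    rw [dist_eq_norm, dist_eq_norm]
    obtain ⟨-, -, A, hA, hA'⟩ := poly_diff p a _ _ (hx u) (hx v) f
    obtain ⟨-, -, B, hB, hB'⟩ := poly_diff p a _ _ (hx u) (hx v) g
    have eA : qf u - qf v = ∑ k, A k * (u - v) k := by
      apply mul_left_cancel₀ hp
      rw [mul_sub, ← hqf, ← hqf, hA, Finset.mul_sum]
      exact Finset.sum_congr rfl fun k _ => by simp; ring
    have eB : qg u - qg v = ∑ k, B k * (u - v) k := by
      apply mul_left_cancel₀ hp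
      rw [mul_sub, ← hqg, ← hqg, hB, Finset.mul_sum]
      exact Finset.sum_congr rfl fun k _ => by simp; ring
    have hunit : IsUnit (A i * B j - A j * B i) := by
      apply isUnit_of_not_dvd p
      intro hd
      apply hu
      have d1 := dvd_sub hd (dvd_sub ((hA' i).mul_right (B j)) ((hA' j).mul_right (B i)))
      have d2 := dvd_sub d1 (dvd_sub ((hB' j).mul_left (eval a (pderiv i f))) ((hB' i).mul_left (eval a (pderiv j f))))
      convert d2 using 1
      simp only [map_sub, map_mul]
      ring
    apply le_antisymm
    · apply norm_le_of_dvd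
      intro d hd k
      by_cases hk : k = i
      · subst hk
        rw [Pi.sub_apply, Ti, Ti, eA]
        exact Finset.dvd_sum fun l _ => (hd l).mul_left _
      by_cases hk' : k = j
      · subst hk'
        rw [Pi.sub_apply, Tj, Tj, eB]
        exact Finset.dvd_sum fun l _ => (hd l).mul_left _
      rw [Pi.sub_apply, Tk _ _ hk hk', Tk _ _ hk hk']
      exact hd k
    · apply norm_le_of_dvd
      intro d hd
      refine lin_dvd p hij A B _ d hunit (fun k hk hk' => ?_) ?_ ?_
      · simpa [Tk _ _ hk hk'] using hd k
      · rw [← eA, ← Ti, ← Ti]; exact hd i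
      · rw [← eB, ← Tj, ← Tj]; exact hd j
  have hmap := map_isom (padicHaar p n) T hT
  simp_rw [hqf, hqg, ← Ti, ← Tj]
  have hmm : Measurable fun y : Fin n → ℤ_[p] => h1 (p * y i) * h2 (p * y j) := by
    have m : ∀ k, Measurable fun y : Fin n → ℤ_[p] => (p : ℤ_[p]) * y k := fun k => 
      (continuous_const.mul (continuous_apply k)).measurable
    exact (hm1.comp (m i)).mul (hm2.comp (m j))
  have e1 := integral_map (μ := padicHaar p n) hT.continuous.measurable.aemeasurable (f := fun y => h1 (p * y i) * h2 (p * y j)) hmm.aestronglyMeasurable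
  rw [← e1, hmap, padicHaar_eq]
  have e2 := integral_fintype_prod_eq_prod (μ := fun _ : Fin n => mu1 p) (𝕜 := ℂ) 
    (fun (k : Fin n) (y : ℤ_[p]) => (if k = i then h1 (p * y) else 1) * (if k = j then h2 (p * y) else 1))
  have e3 : ∀ y : Fin n → ℤ_[p], ∏ k, ((if k = i then h1 (p * y k) else 1) * (if k = j then h2 (p * y k) else 1)) = h1 (p * y i) * h2 (p * y j) := by
    intro y
    rw [Finset.prod_mul_distrib]
    simp
  simp only [e3] at e2
  rw [e2]
  have e4 : ∀ k, ∫ y, (if k = i then h1 (p * y) else 1) * (if k = j then h2 (p * y) else 1) ∂(mu1 p) = 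
     (if k = i then ∫ y, h1 (p * y) ∂(mu1 p) else 1) * (if k = j then ∫ y, h2 (p * y) ∂(mu1 p) else 1) := by
    intro k
    by_cases hk : k = i
    · subst hk; simp [hij]
    by_cases hk' : k = j
    · subst hk'; simp [hk]
    simp [hk, hk']
  simp only [e4]
  rw [Finset.prod_mul_distrib]
  simp

lemma cpow_p_gt (s : ℂ) (hs : 0 < s.re) : (p:ℂ)^(s+1) - 1 ≠ 0 := by
  intro h
  have h1 : ‖(p:ℂ)^(s+1)‖ = 1 := by rw [sub_eq_zero.1 h]; simp
  have hp := (Fact.out : p.Prime).one_lt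
  rw [Complex.norm_natCast_cpow_of_pos (by omega)] at h1
  have : 1 < (p:ℝ)^(s+1).re := Real.one_lt_rpow (by exact_mod_cast hp) (by simp; linarith)
  linarith

lemma norm_p_mul (s : ℂ) (y : ℤ_[p]) : ((‖(p:ℤ_[p]) * y‖ : ℝ) : ℂ) ^ s = (p:ℂ)^(-s) * ((‖y‖ : ℝ) : ℂ) ^ s := by
  rw [norm_mul, PadicInt.norm_p, Complex.ofReal_mul, Complex.mul_cpow_ofReal_nonneg (by positivity) (norm_nonneg _)]
  congr 1
  rw [Complex.ofReal_inv, Complex.ofReal_natCast, Complex.inv_cpow _ _ (by rw [Complex.natCast_arg]; exact Real.pi_pos.ne), Complex.cpow_neg]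

lemma int_pow_p (s : ℂ) (hs : 0 < s.re) : ∫ y, (((‖(p:ℤ_[p]) * y‖ : ℝ)) : ℂ) ^ s ∂(mu1 p) = ((p:ℂ) - 1)/((p:ℂ)^(s+1) - 1) := by
  have hp0 : (p:ℂ) ≠ 0 := by exact_mod_cast (Fact.out : p.Prime).ne_zero
  have hcont : Continuous fun y : ℤ_[p] => (((‖y‖ : ℝ)) : ℂ) ^ s := by
    exact (Complex.continuous_ofReal_cpow_const hs).comp continuous_norm
  have hm : MeasurableSet {x | (p:ℤ_[p]) ∣ x} := by
    simp_rw [← PadicInt.norm_lt_one_iff_dvd]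
    exact (isOpen_lt continuous_norm continuous_const).measurableSet
  have hint : Integrable (fun y : ℤ_[p] => (((‖y‖ : ℝ)) : ℂ) ^ s) (mu1 p) := 
    hcont.integrable_of_hasCompactSupport (HasCompactSupport.of_compactSpace _)
  have h := integral_add_compl hm hint
  have h2 : ∫ x in {x | (p:ℤ_[p]) ∣ x}ᶜ, (((‖x‖ : ℝ)) : ℂ) ^ s ∂(mu1 p) = 1 - (p:ℂ)⁻¹ := by
    rw [setIntegral_congr_fun (g := fun _ => (1:ℂ)) hm.compl]
    · rw [setIntegral_const, measureReal_compl hm]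
      simp [Measure.real, mu1_p]
    · intro x hx
      have : ‖x‖ = 1 := PadicInt.isUnit_iff.1 (isUnit_of_not_dvd p hx)
      simp [this]
  rw [h2, mu1_scale] at h
  simp_rw [norm_p_mul, integral_const_mul] at h ⊢
  set I := ∫ y, (((‖y‖ : ℝ)) : ℂ) ^ s ∂(mu1 p)
  have hne := cpow_p_gt p s hs
  rw [Complex.cpow_add _ _ hp0, Complex.cpow_one] at hne ⊢
  rw [Complex.cpow_neg] at h ⊢
  have hq : (p:ℂ)^s ≠ 0 := by simp [Complex.cpow_eq_zero_iff, hp0]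
  rw [eq_div_iff hne]
  field_simp at h ⊢
  linear_combination -h

lemma norm_one_of_coset {n : ℕ} (g : MvPolynomial (Fin n) ℤ_[p]) (a x : Fin n → ℤ_[p]) (hg : ¬ (p : ℤ_[p]) ∣ eval a g)
    (hx : x ∈ coset p a) : ‖eval x g‖ = 1 := by
  apply PadicInt.isUnit_iff.1 (isUnit_of_not_dvd p fun h => hg ?_)
  exact (dvd_sub_right h).1 (poly_diff p a x x hx hx g).1

lemma meas_h (s : ℂ) (hs : 0 < s.re) : Measurable fun y : ℤ_[p] => (((‖y‖ : ℝ)) : ℂ) ^ s :=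
  ((Complex.continuous_ofReal_cpow_const hs).comp continuous_norm).measurable

lemma int_single {n : ℕ} (hn : 2 ≤ n) (f : MvPolynomial (Fin n) ℤ_[p]) (a : Fin n → ℤ_[p])
    (h1 : ¬ ((p : ℤ_[p]) ∣ eval a f ∧ ∀ i, (p : ℤ_[p]) ∣ eval a (pderiv i f)))
    (hf : (p : ℤ_[p]) ∣ eval a f) (s : ℂ) (hs : 0 < s.re) :
    ∫ x in coset p a, (‖eval x f‖ : ℂ) ^ s ∂(padicHaar p n)
        = (p : ℂ) ^ (-(n : ℤ)) * (((p : ℂ) - 1) / ((p : ℂ) ^ (s + 1) - 1)) := by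
  obtain ⟨i, hi⟩ : ∃ i, ¬ (p : ℤ_[p]) ∣ eval a (pderiv i f) := by
    by_contra! h
    exact h1 ⟨hf, h⟩
  have : Nontrivial (Fin n) := Fin.nontrivial_iff_two_le.2 hn
  obtain ⟨j, hj⟩ := exists_ne i
  have := main_int p f (X j - C (a j)) a hj.symm hf (by simp) (by simpa [pderiv_X, hj, hj.symm] using hi)
    (fun y => (‖y‖ : ℂ) ^ s) (fun _ => 1) (meas_h p s hs) measurable_const
  rw [int_pow_p p s hs] at this
  simpa using this

lemma p_simp : ((p : ℂ) - 1) / ((p : ℂ) ^ ((1:ℂ) + 1) - 1) = 1 / ((p:ℂ) + 1) := by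
  have hp := (Fact.out : p.Prime).one_lt
  have h1 : (p:ℂ) - 1 ≠ 0 := by
    rw [sub_ne_zero]; exact_mod_cast hp.ne'
  have h2 : (p:ℂ) + 1 ≠ 0 := by exact_mod_cast (Nat.succ_ne_zero p)
  have h3 : (p : ℂ) ^ ((1:ℂ) + 1) - 1 = ((p:ℂ) - 1) * ((p:ℂ) + 1) := by
    rw [one_add_one_eq_two, Complex.cpow_ofNat]; ring
  rw [h3]
  field_simp

end PadicAux

theorem integral_coset_poly_measure (p : ℕ) [Fact p.Prime] (n : ℕ) (hn : 2 ≤ n)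
    (f g : MvPolynomial (Fin n) ℤ_[p]) (a : Fin n → ℤ_[p])
    (h1 : ¬ ((p : ℤ_[p]) ∣ eval a f ∧ ∀ i, (p : ℤ_[p]) ∣ eval a (pderiv i f)))
    (h2 : ¬ ((p : ℤ_[p]) ∣ eval a g ∧ ∀ i, (p : ℤ_[p]) ∣ eval a (pderiv i g)))
    (h3 : ¬ ((p : ℤ_[p]) ∣ eval a f ∧ (p : ℤ_[p]) ∣ eval a g ∧
      ∀ i j : Fin n, i < j → (p : ℤ_[p]) ∣
        eval a (pderiv i f * pderiv j g - pderiv j f * pderiv i g)))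
    (s : ℂ) (hs : 0 < s.re) :
    (¬ (p : ℤ_[p]) ∣ eval a f → ¬ (p : ℤ_[p]) ∣ eval a g →
      ∫ x in coset p a, (‖eval x f‖ : ℂ) ^ s * (‖eval x g‖ : ℂ) ∂(padicHaar p n)
        = (p : ℂ) ^ (-(n : ℤ))) ∧
    ((p : ℤ_[p]) ∣ eval a f → ¬ (p : ℤ_[p]) ∣ eval a g →
      ∫ x in coset p a, (‖eval x f‖ : ℂ) ^ s * (‖eval x g‖ : ℂ) ∂(padicHaar p n)
        = (p : ℂ) ^ (-(n : ℤ)) * (((p : ℂ) - 1) / ((p : ℂ) ^ (s + 1) - 1))) ∧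
    (¬ (p : ℤ_[p]) ∣ eval a f → (p : ℤ_[p]) ∣ eval a g →
      ∫ x in coset p a, (‖eval x f‖ : ℂ) ^ s * (‖eval x g‖ : ℂ) ∂(padicHaar p n)
        = (p : ℂ) ^ (-(n : ℤ)) * (1 / ((p : ℂ) + 1))) ∧
    ((p : ℤ_[p]) ∣ eval a f → (p : ℤ_[p]) ∣ eval a g →
      ∫ x in coset p a, (‖eval x f‖ : ℂ) ^ s * (‖eval x g‖ : ℂ) ∂(padicHaar p n)
        = (p : ℂ) ^ (-(n : ℤ)) *
            (((p : ℂ) - 1) / (((p : ℂ) ^ (s + 1) - 1) * ((p : ℂ) + 1)))) := by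
  have hm := PadicAux.coset_meas p a
  refine ⟨fun hf hg => ?_, fun hf hg => ?_, fun hf hg => ?_, fun hf hg => ?_⟩
  · rw [setIntegral_congr_fun (g := fun _ => (1:ℂ)) hm fun x hx => by
      simp [PadicAux.norm_one_of_coset p f a x hf hx, PadicAux.norm_one_of_coset p g a x hg hx],
      PadicAux.coset_int]
    simp
  · rw [setIntegral_congr_fun (g := fun x => (‖eval x f‖ : ℂ) ^ s) hm fun x hx => by
      simp [PadicAux.norm_one_of_coset p g a x hg hx]]
    exact PadicAux.int_single p hn f a h1 hf s hs
  · rw [setIntegral_congr_fun (g := fun x => (‖eval x g‖ : ℂ) ^ (1:ℂ)) hm fun x hx => by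
      simp [PadicAux.norm_one_of_coset p f a x hf hx]]
    rw [PadicAux.int_single p hn g a h2 hg 1 (by simp), PadicAux.p_simp]
  · obtain ⟨i, j, hij, hu⟩ : ∃ i j : Fin n, i < j ∧ ¬ (p : ℤ_[p]) ∣
        eval a (pderiv i f * pderiv j g - pderiv j f * pderiv i g) := by
      by_contra! h
      exact h3 ⟨hf, hg, h⟩
    have := PadicAux.main_int p f g a hij.ne hf hg hu (fun y => (‖y‖ : ℂ) ^ s) (fun y => (‖y‖ : ℂ) ^ (1:ℂ))
      (PadicAux.meas_h p s hs) (PadicAux.meas_h p 1 (by simp))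
    rw [PadicAux.int_pow_p p s hs, PadicAux.int_pow_p p 1 (by simp), PadicAux.p_simp] at this
    simp only [Complex.cpow_one] at this
    rw [this, div_mul_div_comm, mul_one]
end

section
/- Let p be a prime, let f = (f_1,…,f_t) be a polynomial mapping with f_1,…,f_t ∈ ℤ_p[x_1,…,x_n], let g ∈ ℤ_p[x_1,…,x_n], and suppose n ≥ t+1. Let a ∈ ℤ_p^n satisfy the following three conditions: (i) if f_i(a) ≡ 0 mod p for all i, then the t×n Jacobian matrix of (f_1,…,f_t) at a has rank t modulo p; (ii) if g(a) ≡ 0 mod p, then ∂g/∂x_j(a) ≢ 0 mod p for some j; (iii) if f_i(a) ≡ 0 mod p for all i and g(a) ≡ 0 mod p, then the (t+1)×n Jacobian matrix of (f_1,…,f_t,g) at a has rank t+1 modulo p. Then for every complex s with Re(s) > 0: ∫_{a+(pℤ_p)^n} ‖f(x)‖^s |g(x)| dμ equals p^{-n} if f(a) ≢ 0 and g(a) ≢ 0 mod p; equals p^{-n}(p^t−1)/(p^{s+t}−1) if f(a) ≡ 0 and g(a) ≢ 0 mod p; equals p^{-n}/(p+1) if f(a) ≢ 0 and g(a) ≡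 0 mod p; and equals p^{-n}(p^t−1)/((p^{s+t}−1)(p+1)) if f(a) ≡ 0 and g(a) ≡ 0 mod p. Here f(a) ≡ 0 mod p means f_i(a) ≡ 0 mod p for all i, and f(a) ≢ 0 mod p its negation. -/
open MeasureTheory MvPolynomial

/-- `‖F(x)‖ = max_{1≤i≤t} |f_i(x)|`. -/
noncomputable def mapNorm {p n t : ℕ} [Fact p.Prime]
    (F : Fin t → MvPolynomial (Fin n) ℤ_[p]) (x : Fin n → ℤ_[p]) : ℝ :=
  ⨆ i, ‖eval x (F i)‖

section aux

theorem taylor_ideal {R : Type*} [CommRing R] {n : ℕ} (P I : Ideal R) (a x y : Fin n → R)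
    (hx : ∀ k, x k - a k ∈ P) (hy : ∀ k, y k - a k ∈ P) (hI : ∀ k, x k - y k ∈ I)
    (q : MvPolynomial (Fin n) R) :
    eval x q - eval y q - ∑ k, eval a (pderiv k q) * (x k - y k) ∈ P * I := by
  have hev : ∀ q : MvPolynomial (Fin n) R, eval y q - eval a q ∈ P := by
    intro q
    induction q using MvPolynomial.induction_on with
    | C c => simp
    | add q r hq hr =>
      have := P.add_mem hq hr
      simp only [map_add]
      convert this using 1; ring
    | mul_X q i hq =>
      have := P.add_mem (P.mul_mem_right (y i) hq) (P.mul_mem_left (eval a q) (hy i))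
      simp only [map_mul, eval_X]
      convert this using 1; ring
  induction q using MvPolynomial.induction_on with
  | C c => simp
  | add q r hq hr =>
    have := (P * I).add_mem hq hr
    simp only [map_add, add_mul, Finset.sum_add_distrib]
    convert this using 1; ring
  | mul_X q i hq =>
    have h1 := (P * I).mul_mem_right (x i) hq
    have h2 : (∑ k, eval a (pderiv k q) * (x k - y k)) * (x i - a i) ∈ P * I := by
      rw [mul_comm (∑ k, _) (x i - a i)]
      exact Ideal.mul_mem_mul (hx i) (I.sum_mem fun k _ => I.mul_mem_left _ (hI k))
    have h3 : (eval y q - eval a q) * (x i - y i) ∈ P * I := Ideal.mul_mem_mul (hev q) (hI i)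
    have h4 : ∑ k, eval a (pderiv k (q * X i)) * (x k - y k)
        = (∑ k, eval a (pderiv k q) * (x k - y k)) * a i + eval a q * (x i - y i) := by
      have : ∀ k, eval a (pderiv k (q * X i)) * (x k - y k)
        = eval a (pderiv k q) * (x k - y k) * a i
          + if k = i then eval a q * (x i - y i) else 0 := by
        intro k
        by_cases hk : k = i
        · subst hk; simp; ring
        · simp [pderiv_X, hk, Ne.symm hk]; ring
      simp only [this, Finset.sum_add_distrib, Finset.sum_mul]
      simp
    rw [h4]
    have := (P * I).add_mem ((P * I).add_mem h1 h2) h3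
    simp only [map_mul, eval_X]
    convert this using 1; ring

theorem isometry_surj {X : Type*} [MetricSpace X] [CompactSpace X] (f : X → X)
    (hf : Isometry f) : Function.Surjective f := by
  intro y
  by_contra hy
  have hc : IsClosed (Set.range f) := hf.isClosedEmbedding.isClosed_range
  have hd : ∃ ε > 0, ∀ z, ε ≤ dist y (f z) := by
    obtain ⟨ε, h1, h2⟩ := Metric.isOpen_iff.1 hc.isOpen_compl y hy
    refine ⟨ε, h1, fun z => ?_⟩
    by_contra h
    push Not at h
    exact h2 (by rwa [Metric.mem_ball, dist_comm] : f z ∈ Metric.ball y ε) ⟨z, rfl⟩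
  obtain ⟨ε, h1, h2⟩ := hd
  have hit : ∀ k, Isometry (f^[k]) := fun k => by
    induction k with
    | zero => exact isometry_id
    | succ k ih => rw [Function.iterate_succ]; exact ih.comp hf
  have hsep : ∀ k l, k < l → ε ≤ dist (f^[k] y) (f^[l] y) := by
    intro k l hkl
    obtain ⟨d, rfl⟩ := Nat.exists_eq_add_of_lt hkl
    rw [add_assoc, Function.iterate_add_apply, (hit k).dist_eq, Function.iterate_succ_apply']
    exact h2 _
  obtain ⟨x, φ, hφ, hlim⟩ := CompactSpace.tendsto_subseq (fun k => f^[k] y)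
  have hC := hlim.cauchySeq
  obtain ⟨N, hN⟩ := Metric.cauchySeq_iff'.1 hC ε h1
  have := hN (N+1) (by omega)
  have h3 := hsep _ _ (hφ (Nat.lt_succ_self N))
  rw [dist_comm] at this
  exact absurd h3 (not_le.2 this)

theorem padicHaar_univ (p : ℕ) [Fact p.Prime] (n : ℕ) : padicHaar p n Set.univ = 1 :=
  Measure.addHaarMeasure_self

instance padicHaar_prob (p : ℕ) [Fact p.Prime] (n : ℕ) : IsProbabilityMeasure (padicHaar p n) :=
  ⟨padicHaar_univ p n⟩

instance padicHaar_haar (p : ℕ) [Fact p.Prime] (n : ℕ) : (padicHaar p n).IsAddHaarMeasure := by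
  unfold padicHaar; infer_instance

theorem isometry_mp (p : ℕ) [Fact p.Prime] (n : ℕ) (f : (Fin n → ℤ_[p]) → (Fin n → ℤ_[p]))
    (hf : Isometry f) : Measure.map f (padicHaar p n) = padicHaar p n := by
  set μ := padicHaar p n
  have hm : Measurable f := hf.continuous.measurable
  let C : Set (Set (Fin n → ℤ_[p])) := {s | ∃ x, ∃ r, 0 < r ∧ s = Metric.ball x r}
  have : IsProbabilityMeasure (Measure.map f μ) := Measure.isProbabilityMeasure_map hm.aemeasurable
  have hB : TopologicalSpace.IsTopologicalBasis C := by
    apply TopologicalSpace.isTopologicalBasis_of_isOpen_of_nhds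
    · rintro u ⟨x, r, _, rfl⟩; exact Metric.isOpen_ball
    · intro a u ha hu
      obtain ⟨ε, h1, h2⟩ := Metric.isOpen_iff.1 hu a ha
      exact ⟨_, ⟨a, ε, h1, rfl⟩, Metric.mem_ball_self h1, h2⟩
  have hgen := hB.borel_eq_generateFrom
  refine MeasureTheory.ext_of_generate_finite C
    ((BorelSpace.measurable_eq (α := Fin n → ℤ_[p])).trans hgen) ?_ ?_ (by simp [μ])
  · rintro _ ⟨x, r, hr, rfl⟩ _ ⟨y, s, hs, rfl⟩ ⟨z, hz1, hz2⟩
    rw [IsUltrametricDist.ball_eq_of_mem hz1, IsUltrametricDist.ball_eq_of_mem hz2]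
    refine ⟨z, min r s, lt_min hr hs, ?_⟩
    ext w; simp [Metric.mem_ball]
  · rintro _ ⟨y, r, hr, rfl⟩
    rw [Measure.map_apply hm Metric.isOpen_ball.measurableSet]
    obtain ⟨x, rfl⟩ := isometry_surj f hf y
    rw [hf.preimage_ball]
    rw [← zero_add x, ← zero_add (f (0 + x))]
    have key : ∀ x : Fin n → ℤ_[p], μ (Metric.ball x r) = μ (Metric.ball 0 r) := by
      intro x
      have : Metric.ball 0 r = (fun z => x + z) ⁻¹' (Metric.ball x r) := by
        ext z; simp [Metric.mem_ball]
      rw [this, measure_preimage_add]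
    rw [key, key (0 + _)]

theorem toZMod_dvd {p : ℕ} [Fact p.Prime] (x : ℤ_[p]) : PadicInt.toZMod x = 0 ↔ (p : ℤ_[p]) ∣ x := by
  rw [← RingHom.mem_ker, PadicInt.ker_toZMod, PadicInt.maximalIdeal_eq_span_p,
    Ideal.mem_span_singleton]

theorem toZMod_surj {p : ℕ} [Fact p.Prime] :
    Function.Surjective (PadicInt.toZMod : ℤ_[p] →+* ZMod p) := by
  intro z
  exact ⟨(z.val : ℤ_[p]), by simp⟩

/-- coordinate scaling -/
noncomputable def dil (p : ℕ) [Fact p.Prime] {n : ℕ} (S : Finset (Fin n)) :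
    (Fin n → ℤ_[p]) →+ (Fin n → ℤ_[p]) where
  toFun y i := (if i ∈ S then (p : ℤ_[p]) else 1) * y i
  map_zero' := by ext; simp
  map_add' x y := by ext1 i; simp [mul_add]

theorem scale (p : ℕ) [Fact p.Prime] {n : ℕ} (S : Finset (Fin n)) (G : (Fin n → ℤ_[p]) → ℂ) :
    ∫ x in {x | ∀ i ∈ S, (p : ℤ_[p]) ∣ x i}, G x ∂(padicHaar p n)
      = ((p : ℂ) ^ S.card)⁻¹ * ∫ y, G (dil p S y) ∂(padicHaar p n) := by
  set μ := padicHaar p n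
  have hp0 : (p : ℤ_[p]) ≠ 0 := PadicInt.prime_p.ne_zero
  have hinj : Function.Injective (dil p S) := by
    intro x y h
    ext1 i
    have := congrFun h i
    simp only [dil, AddMonoidHom.coe_mk, ZeroHom.coe_mk] at this
    refine mul_left_cancel₀ ?_ this
    split_ifs <;> simp [hp0]
  have hcont : Continuous (dil p S) := by
    simp only [dil, AddMonoidHom.coe_mk, ZeroHom.coe_mk]
    fun_prop
  have hemb : MeasurableEmbedding (dil p S) := (hcont.isClosedEmbedding hinj).measurableEmbedding
  have hrange : Set.range (dil p S) = {x | ∀ i ∈ S, (p : ℤ_[p]) ∣ x i} := by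
    ext x
    constructor
    · rintro ⟨y, rfl⟩ i hi
      simp [dil, hi]
    · intro h
      refine ⟨fun i => if hi : i ∈ S then (h i hi).choose else x i, ?_⟩
      ext1 i
      by_cases hi : i ∈ S
      · simp only [dil, AddMonoidHom.coe_mk, ZeroHom.coe_mk, hi, if_true, dif_pos]
        exact (h i hi).choose_spec.symm
      · simp [dil, hi]
  have hμr : μ (Set.range (dil p S)) = ((p : ENNReal) ^ S.card)⁻¹ := by
    let φ : (Fin n → ℤ_[p]) →+ (S → ZMod p) :=
      { toFun := fun x i => PadicInt.toZMod (x i)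
        map_zero' := by ext; simp
        map_add' := fun x y => by ext; simp }
    have hφ : Function.Surjective φ := by
      intro z
      choose l hl using toZMod_surj (p := p)
      refine ⟨fun i => if hi : i ∈ S then l (z ⟨i, hi⟩) else 0, ?_⟩
      ext1 i
      simp [φ, hl]
    have hk : (φ.ker : Set (Fin n → ℤ_[p])) = Set.range (dil p S) := by
      rw [hrange]
      ext x
      simp [φ, AddMonoidHom.mem_ker, funext_iff, toZMod_dvd]
    have hidx : φ.ker.index = p ^ S.card := by
      rw [AddSubgroup.index_ker, AddMonoidHom.range_eq_top.2 hφ]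
      simp [Nat.card_eq_fintype_card, ZMod.card]
    have : φ.ker.FiniteIndex := ⟨by rw [hidx]; exact pow_ne_zero _ (Fact.out : p.Prime).ne_zero⟩
    have := AddSubgroup.index_mul_measure φ.ker (by rw [hk]; exact hemb.measurableSet_range) μ
    rw [hidx, hk, padicHaar_univ] at this
    rw [mul_comm] at this
    push_cast at this
    exact ENNReal.eq_inv_of_mul_eq_one_left this
  have hcomap : Measure.comap (dil p S) μ = ((p : ENNReal) ^ S.card)⁻¹ • μ := by
    have : IsFiniteMeasure (Measure.comap (dil p S) μ) := ⟨by
      rw [hemb.comap_apply]; exact measure_lt_top _ _⟩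
    have : (Measure.comap (dil p S) μ).IsAddLeftInvariant := by
      refine ⟨fun g => ?_⟩
      ext s hs
      rw [Measure.map_apply (measurable_const_add g) hs, hemb.comap_apply, hemb.comap_apply]
      have : dil p S '' ((fun x => g + x) ⁻¹' s) = (fun x => dil p S g + x) ⁻¹' (dil p S '' s) := by
        ext x
        constructor
        · rintro ⟨y, hy, rfl⟩
          exact ⟨g + y, hy, by simp⟩
        · rintro ⟨y, hy, h⟩
          refine ⟨y - g, by simpa using hy, ?_⟩
          simp only [map_sub, h]; abel
      rw [this, measure_preimage_add]
    have := Measure.addHaarMeasure_unique (Measure.comap (dil p S) μ)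
      ⟨⟨Set.univ, isCompact_univ⟩, by simp⟩
    rw [this]
    congr 1
    rw [hemb.comap_apply, ← hμr, ← Set.image_univ]
    rfl
  rw [← hrange, ← hemb.map_comap, hemb.integral_map, hcomap, integral_smul_measure]
  simp [Complex.real_smul]

theorem exists_prim {p : ℕ} [Fact p.Prime] {n : ℕ} (d : Fin n → ℤ_[p]) (hd : d ≠ 0) :
    ∃ (k : ℕ) (u : Fin n → ℤ_[p]), (∀ i, d i = (p : ℤ_[p]) ^ k * u i) ∧ ∃ i, ¬ (p : ℤ_[p]) ∣ u i := by
  obtain ⟨j, hj⟩ := Function.ne_iff.1 hd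
  have : Nonempty (Fin n) := ⟨j⟩
  obtain ⟨i, hi⟩ := Finite.exists_max (fun i => ‖d i‖)
  have hi0 : d i ≠ 0 := by
    have := hi j
    intro h
    rw [h, norm_zero] at this
    exact hj (norm_le_zero_iff.1 this)
  have hdv : ∀ l, (p : ℤ_[p]) ^ (d i).valuation ∣ d l := by
    intro l
    rw [← Ideal.mem_span_singleton, ← PadicInt.norm_le_pow_iff_mem_span_pow,
      ← PadicInt.norm_eq_zpow_neg_valuation hi0]
    exact hi l
  choose u hu using hdv
  refine ⟨_, u, hu, i, ?_⟩
  rintro ⟨c, hc⟩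
  have h1 := hu i
  have h2 := congrArg norm h1
  rw [hc, norm_mul, norm_mul, PadicInt.norm_p_pow, ← PadicInt.norm_eq_zpow_neg_valuation hi0] at h2
  have h3 : ‖d i‖ ≠ 0 := norm_ne_zero_iff.2 hi0
  have h4 : ‖(p : ℤ_[p])‖ * ‖c‖ = 1 := by
    have : ‖d i‖ * (‖(p : ℤ_[p])‖ * ‖c‖) = ‖d i‖ * 1 := by rw [mul_one]; exact h2.symm
    exact mul_left_cancel₀ h3 this
  have h5 : ‖(p : ℤ_[p]) * c‖ < 1 := (PadicInt.norm_lt_one_iff_dvd _).2 (dvd_mul_right _ _)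
  rw [norm_mul] at h5
  linarith

theorem norm_prim {p : ℕ} [Fact p.Prime] {ι : Type*} [Fintype ι] (u : ι → ℤ_[p])
    (h : ∃ i, ¬ (p : ℤ_[p]) ∣ u i) : ‖u‖ = 1 := by
  apply le_antisymm
  · exact (pi_norm_le_iff_of_nonneg zero_le_one).2 fun i => PadicInt.norm_le_one _
  · obtain ⟨i, hi⟩ := h
    rw [← PadicInt.norm_lt_one_iff_dvd, not_lt] at hi
    exact hi.trans (norm_le_pi_norm u i)

theorem norm_pmul {p : ℕ} [Fact p.Prime] {ι : Type*} [Fintype ι] (c : ℤ_[p]) (u : ι → ℤ_[p]) :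
    ‖fun i => c * u i‖ = ‖c‖ * ‖u‖ := by
  apply le_antisymm
  · refine (pi_norm_le_iff_of_nonneg (by positivity)).2 fun i => ?_
    rw [norm_mul]
    exact mul_le_mul_of_nonneg_left (norm_le_pi_norm u i) (norm_nonneg _)
  · by_cases hc : c = 0
    · simp [hc]
    have hc' : 0 < ‖c‖ := norm_pos_iff.2 hc
    rw [← le_div_iff₀' hc']
    refine (pi_norm_le_iff_of_nonneg (by positivity)).2 fun i => ?_
    rw [le_div_iff₀' hc', ← norm_mul]
    exact norm_le_pi_norm (fun i => c * u i) i

theorem poly_isometry {p : ℕ} [Fact p.Prime] {n : ℕ} (a : Fin n → ℤ_[p])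
    (Φ : Fin n → MvPolynomial (Fin n) ℤ_[p])
    (hJ : LinearIndependent (ZMod p)
      (fun i j => PadicInt.toZMod (eval a (pderiv j (Φ i))) : Fin n → Fin n → ZMod p))
    (Ψ : (Fin n → ℤ_[p]) → (Fin n → ℤ_[p]))
    (hΨ : ∀ z j, eval (fun i => a i + p * z i) (Φ j) = p * Ψ z j) : Isometry Ψ := by
  have hp0 : (p : ℤ_[p]) ≠ 0 := PadicInt.prime_p.ne_zero
  apply Isometry.of_dist_eq
  intro z w
  by_cases hzw : z = w
  · simp [hzw]
  obtain ⟨k, u, hu, hu'⟩ := exists_prim (z - w) (sub_ne_zero.2 hzw)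
  have hT : ∀ j, ∃ c, Ψ z j - Ψ w j
      = (p : ℤ_[p]) ^ k * (∑ l, eval a (pderiv l (Φ j)) * u l + p * c) := by
    intro j
    have := taylor_ideal (Ideal.span {(p : ℤ_[p])}) (Ideal.span {(p : ℤ_[p]) ^ (k+1)}) a
      (fun i => a i + p * z i) (fun i => a i + p * w i)
      (fun i => by simp [Ideal.mem_span_singleton]) (fun i => by simp [Ideal.mem_span_singleton])
      (fun i => by
        rw [Ideal.mem_span_singleton]
        refine ⟨u i, ?_⟩
        have := hu i
        simp only [Pi.sub_apply] at this
        linear_combination (p : ℤ_[p]) * this) (Φ j)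
    rw [Ideal.span_singleton_mul_span_singleton, Ideal.mem_span_singleton] at this
    obtain ⟨c, hc⟩ := this
    refine ⟨c, ?_⟩
    rw [hΨ, hΨ] at hc
    have hs : ∑ l, eval a (pderiv l (Φ j)) * (a l + p * z l - (a l + p * w l))
        = p * ((p : ℤ_[p]) ^ k * ∑ l, eval a (pderiv l (Φ j)) * u l) := by
      rw [Finset.mul_sum, Finset.mul_sum]
      refine Finset.sum_congr rfl fun l _ => ?_
      have := hu l
      simp only [Pi.sub_apply] at this
      linear_combination (p : ℤ_[p]) * eval a (pderiv l (Φ j)) * this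
    rw [hs] at hc
    apply mul_left_cancel₀ hp0
    linear_combination hc
  choose c hc using hT
  have h1 : z - w = fun i => (p : ℤ_[p]) ^ k * u i := funext hu
  have h2 : Ψ z - Ψ w = fun j => (p : ℤ_[p]) ^ k * (∑ l, eval a (pderiv l (Φ j)) * u l + p * c j) :=
    funext hc
  rw [dist_eq_norm, dist_eq_norm, h1, h2, norm_pmul, norm_pmul, norm_prim u hu', norm_prim]
  by_contra hall
  push Not at hall
  have hz : ∀ j, ∑ l, PadicInt.toZMod (eval a (pderiv l (Φ j))) * PadicInt.toZMod (u l) = 0 := by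
    intro j
    have := (toZMod_dvd _).2 (hall j)
    simpa using this
  let M : Matrix (Fin n) (Fin n) (ZMod p) :=
    Matrix.of fun i j => PadicInt.toZMod (eval a (pderiv j (Φ i)))
  have hM : IsUnit M := Matrix.linearIndependent_rows_iff_isUnit.1 hJ
  have hMu : M.mulVec (fun l => PadicInt.toZMod (u l)) = 0 := funext hz
  have hu0 : (fun l => PadicInt.toZMod (u l)) = 0 :=
    Matrix.mulVec_injective_iff_isUnit.2 hM (by rw [hMu, Matrix.mulVec_zero])
  obtain ⟨i, hi⟩ := hu'
  exact hi ((toZMod_dvd _).1 (congrFun hu0 i))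

theorem change_var {p : ℕ} [Fact p.Prime] {n m : ℕ} (a : Fin n → ℤ_[p])
    (H : Fin m → MvPolynomial (Fin n) ℤ_[p]) (hH : ∀ i, (p : ℤ_[p]) ∣ eval a (H i))
    (hJ : LinearIndependent (ZMod p)
      (fun i j => PadicInt.toZMod (eval a (pderiv j (H i))) : Fin m → Fin n → ZMod p)) :
    ∃ e : Fin m → Fin n, Function.Injective e ∧ ∀ G : (Fin m → ℤ_[p]) → ℂ,
      ∫ x in coset p a, G (fun i => eval x (H i)) ∂(padicHaar p n)
        = ((p : ℂ) ^ n)⁻¹ * ∫ y, G (fun i => p * y (e i)) ∂(padicHaar p n) := by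
  classical
  let b := Module.Basis.sumExtend hJ
  have hb : ∀ i, b (Sum.inl i) = fun j => PadicInt.toZMod (eval a (pderiv j (H i))) := fun i => by
    simp [b, Module.Basis.sumExtend]
    rfl
  have : Fintype (Fin m ⊕ Module.Basis.sumExtendIndex hJ) := Module.Basis.fintypeIndexOfRankLtAleph0 b (by
    exact Module.rank_lt_aleph0 _ _)
  have hcard : Fintype.card (Fin m ⊕ Module.Basis.sumExtendIndex hJ) = Fintype.card (Fin n) := by
    rw [← Module.finrank_eq_card_basis b]; simp
  let σ := Fintype.equivOfCardEq hcard
  choose l hl using toZMod_surj (p := p)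
  let Φ' : Fin m ⊕ Module.Basis.sumExtendIndex hJ → MvPolynomial (Fin n) ℤ_[p] :=
    Sum.elim H (fun k => ∑ j, C (l (b (Sum.inr k) j)) * (X j - C (a j)))
  have hΦ' : ∀ k j, PadicInt.toZMod (eval a (pderiv j (Φ' k))) = b k j := by
    rintro (i | k) j
    · rw [hb]; rfl
    · simp only [Φ', Sum.elim_inr, map_sum, pderiv_C_mul, map_sub, pderiv_X, pderiv_C]
      simp [Pi.single_apply, apply_ite, hl]
  have hΦ0 : ∀ k, (p : ℤ_[p]) ∣ eval a (Φ' k) := by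
    rintro (i | k)
    · exact hH i
    · simp [Φ']
  let Φ : Fin n → MvPolynomial (Fin n) ℤ_[p] := fun i => Φ' (σ.symm i)
  have hex : ∀ (z : Fin n → ℤ_[p]) j, ∃ c, eval (fun i => a i + p * z i) (Φ j) = p * c := by
    intro z j
    have := taylor_ideal (Ideal.span {(p : ℤ_[p])}) ⊤ a (fun i => a i + p * z i) a
      (fun i => by simp [Ideal.mem_span_singleton]) (fun i => by simp)
      (fun i => by simp) (Φ j)
    rw [Ideal.mul_top, Ideal.mem_span_singleton] at this
    have h2 : (p : ℤ_[p]) ∣ ∑ k, eval a (pderiv k (Φ j)) * (a k + p * z k - a k) :=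
      Finset.dvd_sum fun k _ => ⟨eval a (pderiv k (Φ j)) * z k, by ring⟩
    have h3 := dvd_add (dvd_add this h2) (hΦ0 (σ.symm j))
    have h4 : (p : ℤ_[p]) ∣ eval (fun i => a i + p * z i) (Φ j) := by simpa [Φ] using h3
    exact h4
  choose Ψ hΨ using hex
  have hiso : Isometry Ψ := by
    refine poly_isometry a Φ ?_ Ψ hΨ
    have := b.linearIndependent.comp σ.symm σ.symm.injective
    have heq : (fun i j => PadicInt.toZMod (eval a (pderiv j (Φ i))) : Fin n → Fin n → ZMod p)
        = b ∘ σ.symm := by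
      ext i j
      exact hΦ' _ _
    rw [heq]
    exact this
  refine ⟨fun i => σ (Sum.inl i), fun i j h => Sum.inl_injective (σ.injective h), fun G => ?_⟩
  have hmp := isometry_mp p n Ψ hiso
  have hemb : MeasurableEmbedding Ψ := hiso.isClosedEmbedding.measurableEmbedding
  conv_rhs => rw [← hmp, hemb.integral_map]
  have hval : ∀ z (i : Fin m), eval (fun j => a j + p * z j) (H i) = p * Ψ z (σ (Sum.inl i)) := by
    intro z i
    rw [← hΨ]
    simp [Φ, Φ']
  simp only [← hval]
  have h1 := scale p (Finset.univ : Finset (Fin n)) (fun x => G fun i => eval (a + x) (H i))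
  have h2 : coset p a = (fun x => -a + x) ⁻¹' {x | ∀ i ∈ (Finset.univ : Finset (Fin n)), (p : ℤ_[p]) ∣ x i} := by
    ext x; simp [coset, sub_eq_neg_add]
  have h3 := (measurePreserving_add_left (padicHaar p n) (-a)).setIntegral_preimage_emb
    (measurableEmbedding_addLeft (-a)) (fun x => G fun i => eval (a + x) (H i))
    {x | ∀ i ∈ (Finset.univ : Finset (Fin n)), (p : ℤ_[p]) ∣ x i}
  rw [← h2, h1] at h3
  simp only [add_neg_cancel_left] at h3
  rw [h3]
  simp only [Finset.card_univ, Fintype.card_fin]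
  congr 1
  refine integral_congr_ae (ae_of_all _ fun y => ?_)
  simp only [dil, Finset.mem_univ, if_true]
  rfl

theorem one_sub_ne {p : ℕ} [Fact p.Prime] (t : ℕ) (s : ℂ) (hs : 0 < s.re) :
    (p : ℂ) ^ (s + t) - 1 ≠ 0 := by
  intro h
  have h1 : ‖(p : ℂ) ^ (s + t)‖ = 1 := by rw [sub_eq_zero.1 h]; simp
  have hp : 1 < p := (Fact.out : p.Prime).one_lt
  rw [Complex.norm_natCast_cpow_of_pos (by omega)] at h1
  have h2 : 1 < (p : ℝ) ^ (s + t).re :=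
    Real.one_lt_rpow (by exact_mod_cast hp) (by simp; positivity)
  linarith

theorem core {p : ℕ} [Fact p.Prime] {n t : ℕ} (e : Fin t → Fin n) (he : Function.Injective e)
    (s : ℂ) (hs : 0 < s.re) (B : (Fin n → ℤ_[p]) → ℂ) (hB : Continuous B)
    (hinv : ∀ y, B (dil p (Finset.univ.image e) y) = B y) :
    ∫ y, ((‖fun i => (p : ℤ_[p]) * y (e i)‖ : ℝ) : ℂ) ^ s * B y ∂(padicHaar p n)
      = (((p : ℂ) ^ t - 1) / ((p : ℂ) ^ (s + t) - 1)) * ∫ y, B y ∂(padicHaar p n) := by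
  set μ := padicHaar p n
  have hp0 : (p : ℂ) ≠ 0 := by exact_mod_cast (Fact.out : p.Prime).ne_zero
  set S := Finset.univ.image e with hS
  have hcard : S.card = t := by
    rw [hS, Finset.card_image_of_injective _ he]; simp
  set A : Set (Fin n → ℤ_[p]) := {x | ∀ i ∈ S, (p : ℤ_[p]) ∣ x i} with hA
  have hAm : MeasurableSet A := by
    have : A = ⋂ i ∈ S, (fun x : Fin n → ℤ_[p] => x i) ⁻¹' {c | (p : ℤ_[p]) ∣ c} := by
      ext x; simp [hA]
    rw [this]
    refine Finset.measurableSet_biInter _ fun i _ => measurable_pi_apply i ?_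
    have : {c : ℤ_[p] | (p : ℤ_[p]) ∣ c} = {c | ‖c‖ < 1} := by
      ext c; simp [PadicInt.norm_lt_one_iff_dvd]
    rw [this]
    exact (isOpen_lt continuous_norm continuous_const).measurableSet
  let N : (Fin n → ℤ_[p]) → ℂ := fun y => ((‖fun i => y (e i)‖ : ℝ) : ℂ) ^ s
  have hN : Continuous N := by
    refine (Complex.continuous_ofReal_cpow_const hs).comp ?_
    fun_prop
  have hint : ∀ f : (Fin n → ℤ_[p]) → ℂ, Continuous f → Integrable f μ := fun f hf =>
    hf.integrable_of_hasCompactSupport (HasCompactSupport.of_compactSpace f)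
  have hpn : ∀ y : Fin n → ℤ_[p], ((‖fun i => (p : ℤ_[p]) * y (e i)‖ : ℝ) : ℂ) ^ s
      = ((p : ℂ) ^ s)⁻¹ * N y := by
    intro y
    rw [norm_pmul, Complex.ofReal_mul, Complex.mul_cpow_ofReal_nonneg (norm_nonneg _) (norm_nonneg _),
      PadicInt.norm_p]
    congr 1
    push_cast
    rw [Complex.inv_cpow _ _ (by rw [Complex.natCast_arg]; exact Real.pi_pos.ne)]
  have hdil : ∀ y, N (dil p S y) = ((p : ℂ) ^ s)⁻¹ * N y := by
    intro y
    rw [← hpn]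
    simp [N, dil, hS]
  have h1 := integral_add_compl hAm (hint (fun y => N y * B y) (hN.mul hB))
  have h2 := integral_add_compl hAm (hint B hB)
  have h3 := scale p S (fun y => N y * B y)
  have h4 := scale p S B
  simp only [hdil, hinv, hcard] at h3 h4
  have h5 : ∫ y in Aᶜ, N y * B y ∂μ = ∫ y in Aᶜ, B y ∂μ := by
    refine setIntegral_congr_fun hAm.compl fun y hy => ?_
    have : ‖fun i => y (e i)‖ = 1 := by
      apply norm_prim
      simpa [hA, hS] using hy
    simp [N, this]
  simp only [hpn, mul_assoc] at h3 ⊢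
  rw [integral_const_mul] at h3 ⊢
  rw [h3, h5] at h1
  rw [h4] at h2
  have hne := one_sub_ne (p := p) t s hs
  have hps : (p : ℂ) ^ s ≠ 0 := by simp [Complex.cpow_eq_zero_iff, hp0]
  have hpt : (p : ℂ) ^ t ≠ 0 := pow_ne_zero _ hp0
  rw [Complex.cpow_add _ _ hp0, Complex.cpow_natCast] at hne ⊢
  set I := ∫ y, N y * B y ∂μ
  set J := ∫ y, B y ∂μ
  set Q := ∫ y in Aᶜ, B y ∂μ
  have h6 : I - ((p : ℂ) ^ t)⁻¹ * (((p : ℂ) ^ s)⁻¹ * I) = J - ((p : ℂ) ^ t)⁻¹ * J := by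
    linear_combination h2 - h1
  rw [div_mul_eq_mul_div, eq_div_iff hne]
  field_simp at h6 ⊢
  linear_combination h6

theorem core1 {p : ℕ} [Fact p.Prime] {n : ℕ} (j : Fin n) :
    ∫ y, ((‖(p : ℤ_[p]) * y j‖ : ℝ) : ℂ) ∂(padicHaar p n) = 1 / ((p : ℂ) + 1) := by
  have h := core (p := p) (t := 1) (fun _ => j) (Function.injective_of_subsingleton _) 1 (by simp)
    (fun _ => 1) continuous_const (fun _ => rfl)
  simp only [Complex.cpow_one, mul_one, pi_norm_const] at h
  rw [h]
  have hp : 1 < p := (Fact.out : p.Prime).one_lt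
  have h1 : (p : ℂ) - 1 ≠ 0 := by
    rw [sub_ne_zero]; exact_mod_cast hp.ne'
  have h2 : (p : ℂ) + 1 ≠ 0 := by exact_mod_cast Nat.succ_ne_zero p
  have h3 : (p : ℂ) ^ ((1 : ℂ) + (1 : ℕ)) = (p : ℂ) ^ 2 := by
    rw [← Complex.cpow_natCast]; norm_num
  rw [h3, show (p : ℂ) ^ 2 - 1 = ((p : ℂ) - 1) * ((p : ℂ) + 1) by ring]
  simp
  field_simp

theorem li_of_rank {p : ℕ} [Fact p.Prime] {m n : ℕ} (v : Fin m → Fin n → ZMod p)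
    (h : Matrix.rank (Matrix.of v) = m) : LinearIndependent (ZMod p) v := by
  rw [linearIndependent_iff_card_eq_finrank_span]
  rw [Matrix.rank_eq_finrank_span_row] at h
  rw [Fintype.card_fin]
  exact h.symm

theorem eval_coset {p : ℕ} [Fact p.Prime] {n : ℕ} {a x : Fin n → ℤ_[p]} (hx : x ∈ coset p a)
    (q : MvPolynomial (Fin n) ℤ_[p]) : (p : ℤ_[p]) ∣ eval x q ↔ (p : ℤ_[p]) ∣ eval a q := by
  have := taylor_ideal (Ideal.span {(p : ℤ_[p])}) ⊤ a x a
    (fun i => Ideal.mem_span_singleton.2 (hx i)) (fun i => by simp) (fun i => by simp) q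
  rw [Ideal.mul_top, Ideal.mem_span_singleton] at this
  have h2 : (p : ℤ_[p]) ∣ ∑ k, eval a (pderiv k q) * (x k - a k) :=
    Finset.dvd_sum fun k _ => Dvd.dvd.mul_left (hx k) _
  have h3 := dvd_add this h2
  rw [sub_add_cancel] at h3
  exact ⟨fun h => (dvd_sub_right h).1 h3, fun h => (dvd_sub_left h).1 h3⟩

theorem mapNorm_eq {p n t : ℕ} [Fact p.Prime]
    (F : Fin t → MvPolynomial (Fin n) ℤ_[p]) (x : Fin n → ℤ_[p]) :
    mapNorm F x = ‖fun i => eval x (F i)‖ := by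
  unfold mapNorm
  rcases isEmpty_or_nonempty (Fin t) with h | h
  · rw [Real.iSup_of_isEmpty, Subsingleton.elim (fun i => eval x (F i)) 0, norm_zero]
  · apply le_antisymm
    · exact ciSup_le fun i => norm_le_pi_norm (fun i => eval x (F i)) i
    · refine (pi_norm_le_iff_of_nonneg (Real.iSup_nonneg fun i => norm_nonneg _)).2 fun i => ?_
      exact le_ciSup (f := fun i => ‖eval x (F i)‖) (Set.finite_range _).bddAbove i

theorem coset_meas {p n : ℕ} [Fact p.Prime] (a : Fin n → ℤ_[p]) : MeasurableSet (coset p a) := by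
  have : coset p a = ⋂ i, (fun x : Fin n → ℤ_[p] => ‖x i - a i‖) ⁻¹' Set.Iio 1 := by
    ext x; simp [coset, PadicInt.norm_lt_one_iff_dvd]
  rw [this]
  refine MeasurableSet.iInter fun i => IsOpen.measurableSet ?_
  exact isOpen_Iio.preimage (by fun_prop)

end aux

theorem integral_coset_map_poly_measure (p : ℕ) [Fact p.Prime] (n t : ℕ)
    (hnt : t + 1 ≤ n)
    (F : Fin t → MvPolynomial (Fin n) ℤ_[p]) (g : MvPolynomial (Fin n) ℤ_[p])
    (a : Fin n → ℤ_[p])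
    (hi : (∀ i, (p : ℤ_[p]) ∣ eval a (F i)) →
      Matrix.rank (Matrix.of fun (i : Fin t) (j : Fin n) =>
        PadicInt.toZMod (eval a (pderiv j (F i)))) = t)
    (hii : (p : ℤ_[p]) ∣ eval a g → ∃ j, ¬ (p : ℤ_[p]) ∣ eval a (pderiv j g))
    (hiii : (∀ i, (p : ℤ_[p]) ∣ eval a (F i)) → (p : ℤ_[p]) ∣ eval a g →
      Matrix.rank (Matrix.of fun (i : Fin (t + 1)) (j : Fin n) =>
        Fin.lastCases (motive := fun _ => ZMod p)
          (PadicInt.toZMod (eval a (pderiv j g)))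
          (fun i' => PadicInt.toZMod (eval a (pderiv j (F i')))) i) = t + 1)
    (s : ℂ) (hs : 0 < s.re) :
    (¬ (∀ i, (p : ℤ_[p]) ∣ eval a (F i)) → ¬ (p : ℤ_[p]) ∣ eval a g →
      ∫ x in coset p a, (mapNorm F x : ℂ) ^ s * (‖eval x g‖ : ℂ) ∂(padicHaar p n)
        = (p : ℂ) ^ (-(n : ℤ))) ∧
    ((∀ i, (p : ℤ_[p]) ∣ eval a (F i)) → ¬ (p : ℤ_[p]) ∣ eval a g →
      ∫ x in coset p a, (mapNorm F x : ℂ) ^ s * (‖eval x g‖ : ℂ) ∂(padicHaar p n)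
        = (p : ℂ) ^ (-(n : ℤ)) * (((p : ℂ) ^ (t : ℕ) - 1) / ((p : ℂ) ^ (s + t) - 1))) ∧
    (¬ (∀ i, (p : ℤ_[p]) ∣ eval a (F i)) → (p : ℤ_[p]) ∣ eval a g →
      ∫ x in coset p a, (mapNorm F x : ℂ) ^ s * (‖eval x g‖ : ℂ) ∂(padicHaar p n)
        = (p : ℂ) ^ (-(n : ℤ)) * (1 / ((p : ℂ) + 1))) ∧
    ((∀ i, (p : ℤ_[p]) ∣ eval a (F i)) → (p : ℤ_[p]) ∣ eval a g →
      ∫ x in coset p a, (mapNorm F x : ℂ) ^ s * (‖eval x g‖ : ℂ) ∂(padicHaar p n)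
        = (p : ℂ) ^ (-(n : ℤ)) *
            (((p : ℂ) ^ (t : ℕ) - 1) / (((p : ℂ) ^ (s + t) - 1) * ((p : ℂ) + 1)))) := by

  have hzp : (p : ℂ) ^ (-(n : ℤ)) = ((p : ℂ) ^ n)⁻¹ := by simp
  have hF1 : ¬ (∀ i, (p : ℤ_[p]) ∣ eval a (F i)) → ∀ x ∈ coset p a, mapNorm F x = 1 := by
    intro h x hx
    rw [mapNorm_eq]
    apply norm_prim
    push Not at h
    obtain ⟨i, hi⟩ := h
    exact ⟨i, fun h => hi ((eval_coset hx _).1 h)⟩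
  have hg1 : ¬ (p : ℤ_[p]) ∣ eval a g → ∀ x ∈ coset p a, ‖eval x g‖ = 1 := by
    intro h x hx
    have h1 : ¬ (p : ℤ_[p]) ∣ eval x g := fun h' => h ((eval_coset hx _).1 h')
    rw [← PadicInt.norm_lt_one_iff_dvd, not_lt] at h1
    exact le_antisymm (PadicInt.norm_le_one _) h1
  have hone : ∫ _ : Fin n → ℤ_[p], (1 : ℂ) ∂(padicHaar p n) = 1 := by simp
  rw [hzp]
  refine ⟨fun hF hg => ?_, fun hF hg => ?_, fun hF hg => ?_, fun hF hg => ?_⟩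
  · obtain ⟨e, he, h⟩ := change_var a (Fin.elim0 : Fin 0 → MvPolynomial (Fin n) ℤ_[p])
      (fun i => i.elim0) (linearIndependent_empty_type)
    have h' := h (fun _ => 1)
    rw [hone, mul_one] at h'
    rw [← h']
    refine setIntegral_congr_fun (coset_meas a) fun x hx => ?_
    simp [hF1 hF x hx, hg1 hg x hx]
  · obtain ⟨e, he, h⟩ := change_var a F hF (li_of_rank _ (hi hF))
    have h' := h (fun v => ((‖v‖ : ℝ) : ℂ) ^ s)
    have h2 := core (p := p) e he s hs (fun _ => 1) continuous_const (fun _ => rfl)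
    rw [hone] at h2
    simp only [mul_one] at h2
    rw [h2] at h'
    rw [← h']
    refine setIntegral_congr_fun (coset_meas a) fun x hx => ?_
    simp [mapNorm_eq, hg1 hg x hx]
  · obtain ⟨j, hj⟩ := hii hg
    obtain ⟨e, he, h⟩ := change_var a (fun _ : Fin 1 => g) (fun _ => hg)
      ((linearIndependent_unique_iff).2 fun h0 => hj ((toZMod_dvd _).1 (congrFun h0 j)))
    have h' := h (fun v => ((‖v 0‖ : ℝ) : ℂ))
    rw [core1 (p := p) (e 0)] at h'
    rw [← h']
    refine setIntegral_congr_fun (coset_meas a) fun x hx => ?_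
    simp [hF1 hF x hx]
  · have hli := li_of_rank _ (hiii hF hg)
    obtain ⟨e, he, h⟩ := change_var a
      (fun i : Fin (t + 1) => Fin.lastCases (motive := fun _ => MvPolynomial (Fin n) ℤ_[p]) g F i)
      (fun i => by
        refine Fin.lastCases ?_ (fun i' => ?_) i
        · simpa using hg
        · simpa using hF i') (by
        convert hli using 1
        ext i j
        refine Fin.lastCases ?_ (fun i' => ?_) i <;> simp)
    have h' := h (fun v => ((‖fun i : Fin t => v i.castSucc‖ : ℝ) : ℂ) ^ s * ((‖v (Fin.last t)‖ : ℝ) : ℂ))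
    have h2 := core (fun i : Fin t => e i.castSucc) (fun i j hij => Fin.castSucc_injective t (he hij))
      s hs (fun y => ((‖(p : ℤ_[p]) * y (e (Fin.last t))‖ : ℝ) : ℂ)) (by fun_prop) (by
        intro y
        have : e (Fin.last t) ∉ Finset.univ.image (fun i : Fin t => e i.castSucc) := by
          simp only [Finset.mem_image, Finset.mem_univ, true_and, not_exists]
          intro i hi'
          exact (Fin.castSucc_lt_last i).ne (he hi')
        simp only [dil, AddMonoidHom.coe_mk, ZeroHom.coe_mk, this, if_false, one_mul])
    rw [h2, core1] at h'
    rw [div_mul_div_comm, mul_one] at h'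
    rw [← h']
    refine setIntegral_congr_fun (coset_meas a) fun x hx => ?_
    simp [mapNorm_eq]
end
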